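/- Let q be a power of 2 and let f be a polynomial over the finite field F_q with (deg f)^4 ≤ q. If f is planar on F_q, then f is a 2-polynomial, i.e., for every i ≥ 1, if the coefficient of X^i in f is nonzero then i is a power of two. -/

import Mathlib

namespace PlanarTwo

open Polynomial

/-- The subgroup of those elements of `AdjoinRoot p` whose `j`-th coordinate in the power basis
lies in `G (e - j)`. -/
def rootFil {B : Type*} [CommRing B] {p : B[X]} (hp : p.Monic) (G : ℤ → AddSubgroup B) (e : ℤ) :
    AddSubgroup (AdjoinRoot p) where
  carrier := {x | ∀ j : ℕ, (AdjoinRoot.modByMonicHom hp x).coeff j ∈ G (e - j)}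
  zero_mem' := fun j => by simp
  add_mem' := fun {x y} hx hy j => by
    rw [map_add, coeff_add]; exact (G _).add_mem (hx j) (hy j)
  neg_mem' := fun {x} hx j => by
    rw [map_neg, coeff_neg]; exact (G _).neg_mem (hx j)

section rootFil

variable {B : Type*} [CommRing B] {p : B[X]} (hp : p.Monic) {G G' : ℤ → AddSubgroup B}

theorem coord_of_mul (b : B) (x : AdjoinRoot p) :
    AdjoinRoot.modByMonicHom hp (AdjoinRoot.of p b * x) =
      C b * AdjoinRoot.modByMonicHom hp x := by
  rw [← AdjoinRoot.algebraMap_eq, ← Algebra.smul_def, map_smul, smul_eq_C_mul]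

theorem mk_coord (x : AdjoinRoot p) : AdjoinRoot.mk p (AdjoinRoot.modByMonicHom hp x) = x :=
  AdjoinRoot.mk_leftInverse hp x

theorem coord_injective : Function.Injective (AdjoinRoot.modByMonicHom hp) :=
  (AdjoinRoot.mk_leftInverse hp).injective

theorem coord_eq_zero_of_le (x : AdjoinRoot p) {j : ℕ} (hj : p.natDegree ≤ j) :
    (AdjoinRoot.modByMonicHom hp x).coeff j = 0 := by
  nontriviality B
  obtain ⟨f, rfl⟩ := AdjoinRoot.mk_surjective x
  rw [AdjoinRoot.modByMonicHom_mk]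
  apply coeff_eq_zero_of_degree_lt
  refine (degree_modByMonic_lt f hp).trans_le ?_
  rw [degree_eq_natDegree hp.ne_zero]
  exact_mod_cast hj

theorem eq_sum_coord (x : AdjoinRoot p) :
    x = ∑ j ∈ Finset.range p.natDegree,
      AdjoinRoot.of p ((AdjoinRoot.modByMonicHom hp x).coeff j) * AdjoinRoot.root p ^ j := by
  set f := AdjoinRoot.modByMonicHom hp x with hf
  have h : f = ∑ j ∈ Finset.range p.natDegree, C (f.coeff j) * X ^ j := by
    ext i
    simp only [finsetSum_coeff, coeff_C_mul, coeff_X_pow, mul_ite, mul_one, mul_zero,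
      Finset.sum_ite_eq, Finset.mem_range]
    split_ifs with hi
    · rfl
    · exact coord_eq_zero_of_le hp x (not_lt.mp hi)
  conv_lhs => rw [← mk_coord hp x, ← hf, h]
  simp only [map_sum, map_mul, map_pow, AdjoinRoot.mk_C, AdjoinRoot.mk_X]

theorem coord_mk_of_natDegree_lt {f : B[X]} (hf : f.degree < p.degree) :
    AdjoinRoot.modByMonicHom hp (AdjoinRoot.mk p f) = f := by
  nontriviality B
  rw [AdjoinRoot.modByMonicHom_mk, (modByMonic_eq_self_iff hp)]; exact hf

theorem root_mul_mem_rootFil {e : ℤ}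
    (h : ∀ (e : ℤ) (x : B), x ∈ G e → ∀ j : ℕ, j < p.natDegree →
      x * p.coeff j ∈ G (e + p.natDegree - j))
    {x : AdjoinRoot p} (hx : x ∈ rootFil hp G e) :
    AdjoinRoot.root p * x ∈ rootFil hp G (e + 1) := by
  rcases subsingleton_or_nontrivial B with hB | hB
  · intro j; rw [Subsingleton.elim (Polynomial.coeff _ j) 0]; exact zero_mem _
  set f := AdjoinRoot.modByMonicHom hp x with hf
  set N := p.natDegree
  intro j
  by_cases hj : N ≤ j
  · rw [coord_eq_zero_of_le hp _ hj]; exact zero_mem _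
  push Not at hj
  have key : AdjoinRoot.modByMonicHom hp (AdjoinRoot.root p * x) =
      X * f - C (f.coeff (N - 1)) * p := by
    rw [← mk_coord hp x, ← hf, ← AdjoinRoot.mk_X, ← map_mul,
      show AdjoinRoot.mk p (X * f) = AdjoinRoot.mk p (X * f - C (f.coeff (N - 1)) * p) by simp]
    apply coord_mk_of_natDegree_lt
    rw [degree_eq_natDegree hp.ne_zero, degree_lt_iff_coeff_zero]
    intro m hm
    change N ≤ m at hm
    obtain ⟨m, rfl⟩ : ∃ m', m = m' + 1 := ⟨m - 1, by omega⟩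
    rw [coeff_sub, coeff_X_mul, coeff_C_mul]
    rcases hm.eq_or_lt with h1 | h1
    · have : p.coeff (m + 1) = 1 := by rw [← h1]; exact hp
      rw [this, h1]; simp
    · rw [coeff_eq_zero_of_natDegree_lt (p := p) h1, hf, coord_eq_zero_of_le hp x (by omega)]
      simp
  rw [key, coeff_sub, coeff_C_mul]
  refine sub_mem ?_ ?_
  · cases j with
    | zero => simp
    | succ j =>
      rw [coeff_X_mul]
      have := hx j
      rwa [show e + 1 - ((j + 1 : ℕ) : ℤ) = e - j by push_cast; ring]
  · have h1 := h _ _ (hx (N - 1)) j hj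
    have : ((N - 1 : ℕ) : ℤ) = N - 1 := by omega
    rwa [this, show e - ((N : ℤ) - 1) + N - j = e + 1 - j by ring] at h1

theorem of_mul_mem_rootFil {e d : ℤ} {b : B}
    (h : ∀ (e : ℤ) (x : B), x ∈ G e → b * x ∈ G' (e + d))
    {x : AdjoinRoot p} (hx : x ∈ rootFil hp G e) :
    AdjoinRoot.of p b * x ∈ rootFil hp G' (e + d) := by
  intro j
  rw [coord_of_mul, coeff_C_mul]
  have := h _ _ (hx j)
  rwa [show e - (j : ℤ) + d = e + d - j by ring] at this

theorem mem_rootFil_of_of_mul_mem {e d : ℤ} {b : B}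
    (h : ∀ (e : ℤ) (x : B), b * x ∈ G' (e + d) → x ∈ G e)
    {x : AdjoinRoot p} (hx : AdjoinRoot.of p b * x ∈ rootFil hp G' (e + d)) :
    x ∈ rootFil hp G e := by
  intro j
  have := hx j
  rw [coord_of_mul, coeff_C_mul, show e + d - (j : ℤ) = e - (j : ℤ) + d by ring] at this
  exact h _ _ this

theorem of_mem_rootFil {e : ℤ} {b : B} (hb : b ∈ G e) :
    AdjoinRoot.of p b ∈ rootFil hp G e := by
  rcases subsingleton_or_nontrivial B with hB | hB
  · intro j; rw [Subsingleton.elim (Polynomial.coeff _ j) 0]; exact zero_mem _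
  intro j
  by_cases hp0 : p.natDegree = 0
  · rw [coord_eq_zero_of_le hp _ (by omega)]; exact zero_mem _
  have : AdjoinRoot.modByMonicHom hp (AdjoinRoot.of p b) = C b := by
    rw [← AdjoinRoot.mk_C]
    apply coord_mk_of_natDegree_lt
    refine degree_C_le.trans_lt ?_
    rw [degree_eq_natDegree hp.ne_zero]
    exact_mod_cast Nat.pos_of_ne_zero hp0
  rw [this, coeff_C]
  split_ifs with h
  · subst h; simpa using hb
  · exact zero_mem _

theorem rootFil_mono (hG : Monotone G) : Monotone (rootFil hp G) := by
  intro e e' h x hx j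
  exact hG (by omega) (hx j)

end rootFil

/-- Polynomials of degree at most `e` with all coefficients in `A`. -/
def polyFil {B : Type*} [CommRing B] (A : AddSubgroup B) (e : ℤ) : AddSubgroup B[X] where
  carrier := {g | ∀ i : ℕ, g.coeff i ∈ A ∧ (e < i → g.coeff i = 0)}
  zero_mem' := fun i => by simp
  add_mem' := fun {x y} hx hy i => by
    rw [coeff_add]
    exact ⟨A.add_mem (hx i).1 (hy i).1, fun h => by rw [(hx i).2 h, (hy i).2 h, add_zero]⟩
  neg_mem' := fun {x} hx i => by
    rw [coeff_neg]
    exact ⟨A.neg_mem (hx i).1, fun h => by rw [(hx i).2 h, neg_zero]⟩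

section polyFil

variable {B : Type*} [CommRing B] {A A' : AddSubgroup B}

theorem polyFil_mono : Monotone (polyFil A) := fun _ _ h _ hx i =>
  ⟨(hx i).1, fun hi => (hx i).2 (h.trans_lt hi)⟩

theorem polyFil_mono_left (h : A ≤ A') {e : ℤ} : polyFil A e ≤ polyFil A' e := fun _ hx i =>
  ⟨h (hx i).1, (hx i).2⟩

theorem mul_mem_polyFil {e d : ℤ} {x g : B[X]} (hx : x ∈ polyFil A e)
    (hg : ∀ i : ℕ, ∀ r ∈ A, r * g.coeff i ∈ A') (hg0 : ∀ i : ℕ, d < i → g.coeff i = 0) :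
    x * g ∈ polyFil A' (e + d) := by
  intro i
  rw [coeff_mul]
  refine ⟨sum_mem fun ab _ => hg _ _ (hx _).1, fun hi => Finset.sum_eq_zero fun ab hab => ?_⟩
  have hs : ab.1 + ab.2 = i := by simpa using hab
  by_cases h : e < ab.1
  · rw [(hx _).2 h, zero_mul]
  · rw [hg0 _ (by omega), mul_zero]

theorem X_mul_mem_polyFil {e : ℤ} {x : B[X]} (hx : x ∈ polyFil A e) :
    X * x ∈ polyFil A (e + 1) := by
  rw [mul_comm]
  refine mul_mem_polyFil hx (fun i r hr => ?_) fun i hi => ?_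
  · rw [coeff_X]; split_ifs <;> simp [hr]
  · rw [coeff_X, if_neg (by omega)]

theorem C_mul_mem_polyFil {e : ℤ} {x : B[X]} {r : B} (hr : ∀ s ∈ A, r * s ∈ A')
    (hx : x ∈ polyFil A e) : C r * x ∈ polyFil A' e := by
  intro i
  rw [coeff_C_mul]
  exact ⟨hr _ (hx i).1, fun h => by rw [(hx i).2 h, mul_zero]⟩

theorem mem_polyFil_of_X_mul_mem {e : ℤ} {x : B[X]} (hx : X * x ∈ polyFil A (e + 1)) :
    x ∈ polyFil A e := by
  intro i
  have := hx (i + 1)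
  rw [coeff_X_mul] at this
  exact ⟨this.1, fun h => this.2 (by push_cast; omega)⟩

theorem mem_polyFil_of_X_sub_C_mul_mem {e : ℤ} {t : B} (hA : A ≤ A')
    (ht : ∀ r, t * r ∈ A' → r ∈ A) {x : B[X]} (hx : (X - C t) * x ∈ polyFil A' (e + 1)) :
    x ∈ polyFil A e := by
  have h1 : ∀ i, x.coeff i ∈ A := by
    intro i
    induction i with
    | zero =>
      have := (hx 0).1
      rw [sub_mul, coeff_sub, coeff_C_mul, mul_coeff_zero, coeff_X_zero, zero_mul, zero_sub,
        neg_mem_iff] at this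
      exact ht _ this
    | succ i ih =>
      have := (hx (i + 1)).1
      rw [sub_mul, coeff_sub, coeff_C_mul, coeff_X_mul] at this
      exact ht _ (by simpa using sub_mem (hA ih) this)
  refine fun i => ⟨h1 i, fun hi => ?_⟩
  by_contra hne
  have hN : i ≤ x.natDegree := le_natDegree_of_ne_zero hne
  have := (hx (x.natDegree + 1)).2 (by push_cast; omega)
  rw [sub_mul, coeff_sub, coeff_C_mul, coeff_X_mul,
    coeff_eq_zero_of_natDegree_lt (Nat.lt_succ_self _), mul_zero, sub_zero] at this
  have hx0 : x = 0 := leadingCoeff_eq_zero.mp this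
  simp [hx0] at hne

theorem C_mem_polyFil {r : B} (hr : r ∈ A) : C r ∈ polyFil A 0 := by
  intro i
  rw [coeff_C]
  split_ifs with h
  · exact ⟨hr, fun h' => by omega⟩
  · simp

end polyFil

section Curve

variable {F : Type*} [Field F] {P : F[X][X]}

/-- The degree filtration on the coordinate ring of a monic plane curve. -/
noncomputable abbrev curveFil (hP : P.Monic) : ℤ → AddSubgroup (AdjoinRoot P) :=
  rootFil hP (polyFil ⊤)

/-- The class of the first coordinate. -/
noncomputable abbrev tR (P : F[X][X]) : AdjoinRoot P := AdjoinRoot.of P X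

/-- The class of the second coordinate. -/
noncomputable abbrev yR (P : F[X][X]) : AdjoinRoot P := AdjoinRoot.root P

variable (hP : P.Monic) (htd : ∀ i j : ℕ, P.natDegree < i + j → (P.coeff j).coeff i = 0)

theorem curveFil_mono : Monotone (curveFil hP) := rootFil_mono hP polyFil_mono

theorem one_mem_curveFil : (1 : AdjoinRoot P) ∈ curveFil hP 0 := by
  rw [← map_one (AdjoinRoot.of P), ← C_1]
  exact of_mem_rootFil hP (C_mem_polyFil trivial)

theorem of_mul_mem_curveFil {e d : ℤ} {g : F[X]} {x : AdjoinRoot P} (hg : g ∈ polyFil ⊤ d)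
    (hx : x ∈ curveFil hP e) : AdjoinRoot.of P g * x ∈ curveFil hP (e + d) := by
  refine of_mul_mem_rootFil hP (fun e x hx => ?_) hx
  rw [mul_comm]
  exact mul_mem_polyFil hx (fun _ _ _ => trivial) fun i hi => (hg i).2 hi

theorem t_mul_mem_curveFil {e : ℤ} {x : AdjoinRoot P} (hx : x ∈ curveFil hP e) :
    tR P * x ∈ curveFil hP (e + 1) :=
  of_mul_mem_rootFil hP (fun _ _ => X_mul_mem_polyFil) hx

theorem scalar_mul_mem_curveFil {e : ℤ} (c : F) {x : AdjoinRoot P} (hx : x ∈ curveFil hP e) :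
    AdjoinRoot.of P (C c) * x ∈ curveFil hP e := by
  simpa using of_mul_mem_curveFil hP (C_mem_polyFil (r := c) trivial) hx

theorem mem_curveFil_of_t_mul_mem {e : ℤ} {x : AdjoinRoot P}
    (hx : tR P * x ∈ curveFil hP (e + 1)) : x ∈ curveFil hP e :=
  mem_rootFil_of_of_mul_mem hP (fun _ _ => mem_polyFil_of_X_mul_mem) hx

include htd in
theorem y_mul_mem_curveFil {e : ℤ} {x : AdjoinRoot P} (hx : x ∈ curveFil hP e) :
    yR P * x ∈ curveFil hP (e + 1) := by
  refine root_mul_mem_rootFil hP (fun e x hx j hj => ?_) hx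
  rw [add_sub_assoc]
  exact mul_mem_polyFil hx (fun _ _ _ => trivial) fun i hi => htd i j (by omega)

include htd in
theorem y_pow_mul_mem_curveFil {e : ℤ} {x : AdjoinRoot P} (hx : x ∈ curveFil hP e) (j : ℕ) :
    yR P ^ j * x ∈ curveFil hP (e + j) := by
  induction j with
  | zero => simpa using hx
  | succ j ih =>
    rw [pow_succ', mul_assoc]
    convert y_mul_mem_curveFil hP htd ih using 2
    push_cast; ring

theorem t_pow_mul_mem_curveFil {e : ℤ} {x : AdjoinRoot P} (hx : x ∈ curveFil hP e) (j : ℕ) :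
    tR P ^ j * x ∈ curveFil hP (e + j) := by
  induction j with
  | zero => simpa using hx
  | succ j ih =>
    rw [pow_succ', mul_assoc]
    convert t_mul_mem_curveFil hP ih using 2
    push_cast; ring

include htd in
theorem mul_mem_curveFil {e d : ℤ} {x x' : AdjoinRoot P} (hx : x ∈ curveFil hP e)
    (hx' : x' ∈ curveFil hP d) : x * x' ∈ curveFil hP (e + d) := by
  rw [eq_sum_coord hP x, Finset.sum_mul]
  refine sum_mem fun j _ => ?_
  rw [mul_assoc]
  have := of_mul_mem_curveFil hP (hx j) (y_pow_mul_mem_curveFil hP htd hx' j)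
  rwa [show d + (j : ℤ) + (e - j) = e + d by ring] at this

include htd in
theorem pow_mem_curveFil {e : ℤ} {x : AdjoinRoot P} (hx : x ∈ curveFil hP e) (k : ℕ) :
    x ^ k ∈ curveFil hP (k * e) := by
  induction k with
  | zero => simpa using one_mem_curveFil hP
  | succ k ih =>
    rw [pow_succ]
    convert mul_mem_curveFil hP htd ih hx using 2
    push_cast; ring

end Curve

section Secant

variable {F : Type*} [Field F] {P : F[X][X]}

/-- The quotient of `P` by the linear factor belonging to the tautological root. -/
noncomputable def secPoly (P : F[X][X]) : (AdjoinRoot P)[X] :=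
  P.map (AdjoinRoot.of P) /ₘ (X - C (yR P))

theorem X_sub_C_mul_secPoly (P : F[X][X]) :
    (X - C (yR P)) * secPoly P = P.map (AdjoinRoot.of P) :=
  mul_divByMonic_eq_iff_isRoot.mpr (AdjoinRoot.isRoot_root P)

theorem secPoly_monic (hP : P.Monic) : (secPoly P).Monic := by
  apply Monic.of_mul_monic_left (monic_X_sub_C (yR P))
  rw [X_sub_C_mul_secPoly]
  exact hP.map _

theorem natDegree_secPoly (hP : P.Monic) (hn : 1 ≤ P.natDegree) :
    (secPoly P).natDegree = P.natDegree - 1 := by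
  have : Nontrivial (AdjoinRoot P) :=
    AdjoinRoot.nontrivial P (by
      rw [degree_eq_natDegree hP.ne_zero]
      exact_mod_cast (by omega : P.natDegree ≠ 0))
  have h := congrArg natDegree (X_sub_C_mul_secPoly P)
  rw [(monic_X_sub_C (yR P)).natDegree_mul (secPoly_monic hP), natDegree_X_sub_C,
    hP.natDegree_map] at h
  omega

variable (hP : P.Monic) (htd : ∀ i j : ℕ, P.natDegree < i + j → (P.coeff j).coeff i = 0)

include htd in
theorem of_coeff_mem (j : ℕ) : AdjoinRoot.of P (P.coeff j) ∈ curveFil hP (P.natDegree - j) :=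
  of_mem_rootFil hP fun i => ⟨trivial, fun hi => htd i j (by omega)⟩

include htd in
theorem secPoly_coeff_mem (l : ℕ) :
    (secPoly P).coeff l ∈ curveFil hP (P.natDegree - 1 - l) := by
  rw [secPoly, coeff_divByMonic_X_sub_C]
  refine sum_mem fun i hi => ?_
  rw [coeff_map]
  have := y_pow_mul_mem_curveFil hP htd (of_coeff_mem hP htd i) (i - (l + 1))
  have h2 := (Finset.mem_Icc.mp hi).1
  push_cast [h2] at this
  convert this using 2
  ring

/-- The degree filtration on the ring of pairs of points with the same first coordinate. -/
noncomputable abbrev secFil (hP : P.Monic) : ℤ → AddSubgroup (AdjoinRoot (secPoly P)) :=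
  rootFil (secPoly_monic hP) (curveFil hP)

include htd in
theorem root_mul_mem_secFil (hn : 1 ≤ P.natDegree) {e : ℤ} {x : AdjoinRoot (secPoly P)}
    (hx : x ∈ secFil hP e) : AdjoinRoot.root (secPoly P) * x ∈ secFil hP (e + 1) := by
  refine root_mul_mem_rootFil _ (fun e x hx j hj => ?_) hx
  have := mul_mem_curveFil hP htd hx (secPoly_coeff_mem hP htd j)
  rw [natDegree_secPoly hP hn]
  push_cast [hn]
  convert this using 2
  ring

include htd in
theorem root_pow_mul_mem_secFil (hn : 1 ≤ P.natDegree) {e : ℤ} {x : AdjoinRoot (secPoly P)}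
    (hx : x ∈ secFil hP e) (j : ℕ) :
    AdjoinRoot.root (secPoly P) ^ j * x ∈ secFil hP (e + j) := by
  induction j with
  | zero => simpa using hx
  | succ j ih =>
    rw [pow_succ', mul_assoc]
    convert root_mul_mem_secFil hP htd hn ih using 2
    push_cast; ring

theorem mem_secFil_of_t_pow_mul_mem {e : ℤ} {x : AdjoinRoot (secPoly P)} {k : ℕ}
    (hx : AdjoinRoot.of (secPoly P) (tR P) ^ k * x ∈ secFil hP (e + k)) : x ∈ secFil hP e := by
  induction k with
  | zero => simpa using hx
  | succ k ih =>
    apply ih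
    rw [pow_succ', mul_assoc] at hx
    push_cast at hx
    rw [← add_assoc] at hx
    exact mem_rootFil_of_of_mul_mem _ (fun _ _ h => mem_curveFil_of_t_mul_mem hP h) hx

/-- The scalars in the coordinate ring. -/
noncomputable abbrev scal (P : F[X][X]) : F →+* AdjoinRoot P := (AdjoinRoot.of P).comp C

/-- The defining polynomial of the second factor in the product of the curve with itself. -/
noncomputable abbrev prodPoly (P : F[X][X]) : (AdjoinRoot P)[X][X] :=
  P.map (mapRingHom (scal P))

include hP in
theorem prodPoly_monic : (prodPoly P).Monic := hP.map _

/-- The bidegree filtration on the coordinate ring of the product of the curve with itself. -/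
noncomputable abbrev biFil (hP : P.Monic) (a b : ℤ) : AddSubgroup (AdjoinRoot (prodPoly P)) :=
  rootFil (prodPoly_monic hP) (polyFil (curveFil hP a)) b

/-- First projection. -/
noncomputable abbrev fstR (P : F[X][X]) : AdjoinRoot P →+* AdjoinRoot (prodPoly P) :=
  (AdjoinRoot.of (prodPoly P)).comp C

/-- The first coordinate of the second point. -/
noncomputable abbrev t₂ (P : F[X][X]) : AdjoinRoot (prodPoly P) := AdjoinRoot.of (prodPoly P) X

/-- The second coordinate of the second point. -/
noncomputable abbrev y₂ (P : F[X][X]) : AdjoinRoot (prodPoly P) := AdjoinRoot.root (prodPoly P)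

theorem biFil_mono {a b a' b' : ℤ} (ha : a ≤ a') (hb : b ≤ b') : biFil hP a b ≤ biFil hP a' b' :=
  fun _ hx j => polyFil_mono (by omega) (polyFil_mono_left (curveFil_mono hP ha) (hx j))

theorem one_mem_biFil : (1 : AdjoinRoot (prodPoly P)) ∈ biFil hP 0 0 := by
  rw [← map_one (AdjoinRoot.of (prodPoly P)), ← C_1]
  exact of_mem_rootFil _ (C_mem_polyFil (one_mem_curveFil hP))

theorem fst_mul_mem_biFil {a a' b : ℤ} {r : AdjoinRoot P}
    (hr : ∀ s ∈ curveFil hP a, r * s ∈ curveFil hP a')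
    {x : AdjoinRoot (prodPoly P)} (hx : x ∈ biFil hP a b) : fstR P r * x ∈ biFil hP a' b := by
  have := of_mul_mem_rootFil (prodPoly_monic hP) (G' := polyFil (curveFil hP a')) (d := 0)
    (fun e x hx => by rw [add_zero]; exact C_mul_mem_polyFil hr hx) hx
  rwa [add_zero] at this

theorem t₂_mul_mem_biFil {a b : ℤ} {x : AdjoinRoot (prodPoly P)} (hx : x ∈ biFil hP a b) :
    t₂ P * x ∈ biFil hP a (b + 1) :=
  of_mul_mem_rootFil _ (fun _ _ => X_mul_mem_polyFil) hx

include htd in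
theorem y₂_mul_mem_biFil {a b : ℤ} {x : AdjoinRoot (prodPoly P)} (hx : x ∈ biFil hP a b) :
    y₂ P * x ∈ biFil hP a (b + 1) := by
  refine root_mul_mem_rootFil _ (fun e x hx j hj => ?_) hx
  rcases subsingleton_or_nontrivial (AdjoinRoot P) with hs | hs
  · rw [Subsingleton.elim (x * _) 0]; exact zero_mem _
  rw [hP.natDegree_map, add_sub_assoc, coeff_map]
  refine mul_mem_polyFil hx (fun i r hr => ?_) fun i hi => ?_
  · rw [coe_mapRingHom, coeff_map, mul_comm]
    exact scalar_mul_mem_curveFil hP _ hr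
  · rw [coe_mapRingHom, coeff_map, htd i j (by omega), map_zero]

theorem mem_biFil_of_diff_mul_mem {a b : ℤ} {x : AdjoinRoot (prodPoly P)}
    (hx : (t₂ P - fstR P (tR P)) * x ∈ biFil hP (a + 1) (b + 1)) : x ∈ biFil hP a b := by
  have h : t₂ P - fstR P (tR P) = AdjoinRoot.of (prodPoly P) (X - C (tR P)) := by
    simp only [map_sub, RingHom.comp_apply]
  rw [h] at hx
  exact mem_rootFil_of_of_mul_mem _ (fun e x hx => mem_polyFil_of_X_sub_C_mul_mem
    (curveFil_mono hP (by omega)) (fun r hr => mem_curveFil_of_t_mul_mem hP hr) hx) hx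

theorem map_eval_prodPoly : (prodPoly P).map (evalRingHom (tR P)) = P.map (AdjoinRoot.of P) := by
  rw [prodPoly, map_map]
  congr 1
  ext <;> simp

theorem eval₂_prodPoly :
    (prodPoly P).eval₂ ((AdjoinRoot.of (secPoly P)).comp (evalRingHom (tR P)))
      (AdjoinRoot.root (secPoly P)) = 0 := by
  rw [← eval₂_map, map_eval_prodPoly, ← X_sub_C_mul_secPoly, eval₂_mul, AdjoinRoot.eval₂_root,
    mul_zero]

/-- Restriction from the product to the pairs of distinct points with the same first
coordinate. -/
noncomputable def restr (P : F[X][X]) : AdjoinRoot (prodPoly P) →+* AdjoinRoot (secPoly P) :=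
  AdjoinRoot.lift _ _ (eval₂_prodPoly (P := P))

theorem restr_of (f : (AdjoinRoot P)[X]) :
    restr P (AdjoinRoot.of _ f) = AdjoinRoot.of _ (f.eval (tR P)) := by
  simp [restr]

theorem restr_fst (r : AdjoinRoot P) : restr P (fstR P r) = AdjoinRoot.of _ r := by
  simp [restr]

theorem restr_mk (f : (AdjoinRoot P)[X][X]) :
    restr P (AdjoinRoot.mk _ f) = AdjoinRoot.mk _ (f.map (evalRingHom (tR P))) := by
  rw [restr, AdjoinRoot.lift_mk, ← eval₂_map]
  conv_rhs => rw [← AdjoinRoot.aeval_eq]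
  rfl

theorem eval_mem_curveFil {a b : ℤ} {f : (AdjoinRoot P)[X]} (hf : f ∈ polyFil (curveFil hP a) b) :
    f.eval (tR P) ∈ curveFil hP (a + b) := by
  rw [eval_eq_sum_range]
  refine sum_mem fun i _ => ?_
  by_cases h : b < i
  · rw [(hf i).2 h, zero_mul]; exact zero_mem _
  rw [mul_comm]
  exact curveFil_mono hP (by omega) (t_pow_mul_mem_curveFil hP (hf i).1 i)

include htd in
theorem restr_mem_secFil (hn : 1 ≤ P.natDegree) {a b : ℤ} {x : AdjoinRoot (prodPoly P)}
    (hx : x ∈ biFil hP a b) : restr P x ∈ secFil hP (a + b) := by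
  rw [eq_sum_coord (prodPoly_monic hP) x, map_sum]
  refine sum_mem fun j _ => ?_
  rw [map_mul, map_pow, restr_of, mul_comm, restr, AdjoinRoot.lift_root]
  have := root_pow_mul_mem_secFil hP htd hn (of_mem_rootFil (secPoly_monic hP)
    (eval_mem_curveFil hP (hx j))) j
  convert this using 2
  ring

theorem exists_of_restr_eq_zero {x : AdjoinRoot (prodPoly P)} (hx : restr P x = 0) :
    ∃ z, (y₂ P - fstR P (yR P)) * x = (t₂ P - fstR P (tR P)) * z := by
  obtain ⟨f, rfl⟩ := AdjoinRoot.mk_surjective x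
  rw [restr_mk, AdjoinRoot.mk_eq_zero] at hx
  obtain ⟨g, hg⟩ := hx
  set Δ : (AdjoinRoot P)[X][X] := (X - C (C (yR P))) * f - prodPoly P * g.map C with hΔ
  have hmap : Δ.map (evalRingHom (tR P)) = 0 := by
    rw [hΔ, Polynomial.map_sub, Polynomial.map_mul, Polynomial.map_mul, map_eval_prodPoly,
      map_map, ← X_sub_C_mul_secPoly, hg]
    have : (evalRingHom (tR P)).comp C = RingHom.id _ := RingHom.ext fun r => by simp
    rw [this, map_id]
    simp
    ring
  have hdvd : C (X - C (tR P)) ∣ Δ := by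
    rw [C_dvd_iff_dvd_coeff]
    intro i
    rw [dvd_iff_isRoot, IsRoot, ← coe_evalRingHom, ← coeff_map, hmap, coeff_zero]
  obtain ⟨Δ', h'⟩ := hdvd
  refine ⟨AdjoinRoot.mk _ Δ', ?_⟩
  have := congrArg (AdjoinRoot.mk (prodPoly P)) (hΔ.symm.trans h')
  simpa using this

end Secant

section Chain

variable {F : Type*} [Field F] {P : F[X][X]}

/-- `x` is a sequence of successive quotients of `x 0` by the ideal of the diagonal, up to
step `k`. -/
def IsChain (P : F[X][X]) (k : ℕ) (x : ℕ → AdjoinRoot (prodPoly P)) : Prop :=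
  ∀ j < k, (y₂ P - fstR P (yR P)) * x j = (t₂ P - fstR P (tR P)) * x (j + 1) ∧ restr P (x j) = 0

theorem IsChain.sub {k : ℕ} {x x' : ℕ → AdjoinRoot (prodPoly P)} (h : IsChain P k x)
    (h' : IsChain P k x') : IsChain P k (x - x') := fun j hj => by
  simp only [Pi.sub_apply, mul_sub, (h j hj).1, (h' j hj).1, map_sub, (h j hj).2, (h' j hj).2,
    sub_self, and_self]

theorem IsChain.pow_mul_zero {k : ℕ} {x : ℕ → AdjoinRoot (prodPoly P)} (h : IsChain P k x)
    {j : ℕ} (hj : j ≤ k) :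
    (y₂ P - fstR P (yR P)) ^ j * x 0 = (t₂ P - fstR P (tR P)) ^ j * x j := by
  induction j with
  | zero => simp
  | succ j ih =>
    rw [pow_succ', mul_assoc, ih (by omega), mul_left_comm, (h j (by omega)).1, pow_succ]
    ring

variable (hP : P.Monic) (htd : ∀ i j : ℕ, P.natDegree < i + j → (P.coeff j).coeff i = 0)

theorem mem_biFil_of_diff_pow_mul_mem {a b : ℤ} {k : ℕ} {x : AdjoinRoot (prodPoly P)}
    (hx : (t₂ P - fstR P (tR P)) ^ k * x ∈ biFil hP (a + k) (b + k)) : x ∈ biFil hP a b := by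
  induction k with
  | zero => simpa using hx
  | succ k ih =>
    apply ih
    rw [pow_succ', mul_assoc] at hx
    push_cast at hx
    rw [← add_assoc, ← add_assoc] at hx
    exact mem_biFil_of_diff_mul_mem hP hx

include htd in
theorem det_mul_mem_biFil {a b : ℤ} {x : AdjoinRoot (prodPoly P)} (hx : x ∈ biFil hP a b) :
    (fstR P (tR P) * y₂ P - fstR P (yR P) * t₂ P) * x ∈ biFil hP (a + 1) (b + 1) := by
  rw [sub_mul, mul_assoc, mul_assoc]
  exact sub_mem
    (fst_mul_mem_biFil hP (fun s hs => t_mul_mem_curveFil hP hs) (y₂_mul_mem_biFil hP htd hx))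
    (fst_mul_mem_biFil hP (fun s hs => y_mul_mem_curveFil hP htd hs) (t₂_mul_mem_biFil hP hx))

include htd in
theorem det_pow_mul_mem_biFil {a b : ℤ} {x : AdjoinRoot (prodPoly P)} (hx : x ∈ biFil hP a b)
    (k : ℕ) :
    (fstR P (tR P) * y₂ P - fstR P (yR P) * t₂ P) ^ k * x ∈ biFil hP (a + k) (b + k) := by
  induction k with
  | zero => simpa using hx
  | succ k ih =>
    rw [pow_succ', mul_assoc]
    convert det_mul_mem_biFil hP htd ih using 2 <;> (push_cast; ring)

include htd in
theorem IsChain.restr_mem (hn : 1 ≤ P.natDegree) {a b : ℤ} {k : ℕ}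
    {x : ℕ → AdjoinRoot (prodPoly P)} (h : IsChain P k x) (h0 : x 0 ∈ biFil hP a b) :
    restr P (x k) ∈ secFil hP (a + b - k) := by
  set t₁ := fstR P (tR P) with ht₁
  set y₁ := fstR P (yR P) with hy₁
  set w := ∑ i ∈ Finset.range (k + 1), t₁ ^ i * (-y₁) ^ (k - i) * (k.choose i : AdjoinRoot _) * x i
    with hw
  have hdet : (t₁ * y₂ P - y₁ * t₂ P) ^ k * x 0 = (t₂ P - t₁) ^ k * w := by
    rw [show t₁ * y₂ P - y₁ * t₂ P = t₁ * (y₂ P - y₁) + (-y₁) * (t₂ P - t₁) by ring, add_pow,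
      Finset.sum_mul, hw, Finset.mul_sum]
    refine Finset.sum_congr rfl fun i hi => ?_
    have hi' : i ≤ k := by simpa [Nat.lt_succ_iff] using hi
    have := h.pow_mul_zero hi'
    rw [mul_pow, mul_pow]
    calc _ = t₁ ^ i * (-y₁) ^ (k - i) * (t₂ P - t₁) ^ (k - i) * (k.choose i : AdjoinRoot _) *
          ((y₂ P - y₁) ^ i * x 0) := by ring
      _ = t₁ ^ i * (-y₁) ^ (k - i) * (k.choose i : AdjoinRoot _) * x i *
          ((t₂ P - t₁) ^ (k - i) * (t₂ P - t₁) ^ i) := by rw [this]; ring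
      _ = _ := by rw [← pow_add, Nat.sub_add_cancel hi']; ring
  have hwmem : w ∈ biFil hP a b :=
    mem_biFil_of_diff_pow_mul_mem hP (hdet ▸ det_pow_mul_mem_biFil hP htd h0 k)
  have hr : restr P w = AdjoinRoot.of (secPoly P) (tR P) ^ k * restr P (x k) := by
    rw [hw, map_sum, Finset.sum_range_succ, Finset.sum_eq_zero, zero_add]
    · rw [map_mul, map_mul, map_mul, map_pow, ht₁, restr_fst]
      simp
    · intro i hi
      rw [map_mul, (h i (Finset.mem_range.mp hi)).2, mul_zero]
  refine mem_secFil_of_t_pow_mul_mem hP (k := k) ?_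
  rw [← hr, sub_add_cancel]
  exact restr_mem_secFil hP htd hn hwmem

/-- Index set of the coordinates of `secFil e`. -/
def triSet (n e : ℕ) : Finset (ℕ × ℕ × ℕ) :=
  (Finset.range n ×ˢ Finset.range (n - 1) ×ˢ Finset.range (e + 1)).filter
    fun p => p.1 + p.2.1 + p.2.2 ≤ e

/-- Coordinates on the ring of pairs of points with the same first coordinate. -/
noncomputable def secCoord (x : AdjoinRoot (secPoly P)) (p : ℕ × ℕ × ℕ) : F :=
  ((AdjoinRoot.modByMonicHom hP
    ((AdjoinRoot.modByMonicHom (secPoly_monic hP) x).coeff p.2.1)).coeff p.1).coeff p.2.2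

theorem secFil_ext (hn : 1 ≤ P.natDegree) {e : ℕ} {x x' : AdjoinRoot (secPoly P)}
    (hx : x ∈ secFil hP e) (hx' : x' ∈ secFil hP e)
    (h : ∀ p ∈ triSet P.natDegree e, secCoord hP x p = secCoord hP x' p) : x = x' := by
  apply coord_injective (secPoly_monic hP)
  ext1 l
  by_cases hl : P.natDegree - 1 ≤ l
  · rw [coord_eq_zero_of_le _ _ (by rwa [natDegree_secPoly hP hn]),
      coord_eq_zero_of_le _ _ (by rwa [natDegree_secPoly hP hn])]
  apply coord_injective hP
  ext1 j
  by_cases hj : P.natDegree ≤ j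
  · rw [coord_eq_zero_of_le _ _ hj, coord_eq_zero_of_le _ _ hj]
  ext1 i
  by_cases hi : e < j + l + i
  · rw [(hx l j i).2 (by omega), (hx' l j i).2 (by omega)]
  · refine h (j, l, i) ?_
    simp only [triSet, Finset.mem_filter, Finset.mem_product, Finset.mem_range]
    omega

variable [Fintype F] {M : Type*} [Fintype M] (L : (M → F) →+ AdjoinRoot (prodPoly P))

/-- The coefficient vectors whose associated function vanishes along the diagonal to order `k`. -/
def chainSub (k : ℕ) : AddSubgroup (M → F) where
  carrier := {c | ∃ x, x 0 = L c ∧ IsChain P k x}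
  zero_mem' := ⟨0, by simp, fun j _ => by simp⟩
  add_mem' := by
    rintro c c' ⟨x, hx0, hx⟩ ⟨x', hx0', hx'⟩
    refine ⟨x - (0 - x'), by simp [hx0, hx0'], hx.sub (IsChain.sub (fun j _ => by simp) hx')⟩
  neg_mem' := by
    rintro c ⟨x, hx0, hx⟩
    exact ⟨0 - x, by simp [hx0], IsChain.sub (fun j _ => by simp) hx⟩

include htd in
theorem card_chainSub_le (hn : 1 ≤ P.natDegree) {a b k : ℕ} (hk : k ≤ a + b)
    (hL : ∀ c, L c ∈ biFil hP a b) :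
    Nat.card (chainSub L k) ≤
      Nat.card (chainSub L (k + 1)) *
        Fintype.card F ^ (triSet P.natDegree (a + b - k)).card := by
  classical
  choose! x hx0 hx using fun c (hc : c ∈ chainSub L k) => hc
  let Φ : chainSub L k → (triSet P.natDegree (a + b - k) → F) :=
    fun c p => secCoord hP (restr P (x c k)) p
  have hmem : ∀ c ∈ chainSub L k, restr P (x c k) ∈ secFil hP ((a + b - k : ℕ) : ℤ) := by
    intro c hc
    have := (hx c hc).restr_mem hP htd hn (a := a) (b := b) (by rw [hx0 c hc]; exact hL c)
    push_cast [hk]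
    exact this
  have hΦ : ∀ c c' : chainSub L k, Φ c = Φ c' → (c - c' : M → F) ∈ chainSub L (k + 1) := by
    intro c c' h
    have heq : restr P (x c k) = restr P (x c' k) := secFil_ext hP hn (hmem c c.2) (hmem c' c'.2)
      fun p hp => congrFun h ⟨p, hp⟩
    have hr : restr P ((x c - x c') k) = 0 := by simp [heq]
    obtain ⟨z, hz⟩ := exists_of_restr_eq_zero hr
    have hch := (hx c c.2).sub (hx c' c'.2)
    refine ⟨fun j => if j = k + 1 then z else (x c - x c') j, ?_, ?_⟩
    · simp [hx0 c c.2, hx0 c' c'.2]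
    · intro j hj
      rcases Nat.lt_succ_iff_lt_or_eq.mp hj with h1 | rfl
      · simpa [h1.ne, (show j ≠ k + 1 by omega)] using hch j h1
      · simpa using ⟨by simpa using hz, by simpa using hr⟩
  rw [Nat.card_eq_fintype_card, Nat.card_eq_fintype_card, ← Finset.card_univ (α := chainSub L k)]
  have hcard := Finset.card_le_mul_card_image (f := Φ) (s := Finset.univ)
    (Fintype.card (chainSub L (k + 1))) ?_
  · refine hcard.trans (Nat.mul_le_mul_left _ ?_)
    refine (Finset.card_le_univ _).trans ?_
    rw [Fintype.card_fun, Fintype.card_coe]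
  · intro v hv
    obtain ⟨c', -, rfl⟩ := Finset.mem_image.mp hv
    rw [← Fintype.card_coe]
    refine Fintype.card_le_of_injective
      (fun c => (⟨(c.1 : M → F) - c', hΦ _ _ (Finset.mem_filter.mp c.2).2⟩ :
        chainSub L (k + 1))) ?_
    intro c d hcd
    have := congrArg Subtype.val hcd
    exact Subtype.ext (Subtype.ext (sub_left_injective this))

include htd in
theorem exists_chain (hn : 1 ≤ P.natDegree) {a b m : ℕ} (hm : m ≤ a + b + 1)
    (hL : ∀ c, L c ∈ biFil hP a b)
    (hcount : ∑ k ∈ Finset.range m, (triSet P.natDegree (a + b - k)).card < Fintype.card M) :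
    ∃ c ≠ 0, ∃ x, x 0 = L c ∧ IsChain P m x := by
  classical
  have h1 : ∀ r ≤ m, Nat.card (chainSub L 0) ≤ Nat.card (chainSub L r) *
      Fintype.card F ^ ∑ k ∈ Finset.range r, (triSet P.natDegree (a + b - k)).card := by
    intro r hr
    induction r with
    | zero => simp
    | succ r ih =>
      refine (ih (by omega)).trans ?_
      rw [Finset.sum_range_succ, pow_add, mul_comm (_ ^ _), ← mul_assoc]
      exact Nat.mul_le_mul_right _ (card_chainSub_le hP htd L hn (by omega) hL)
  have htop : chainSub L 0 = ⊤ := by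
    ext c
    exact ⟨fun _ => trivial, fun _ => ⟨fun _ => L c, rfl, fun j hj => by omega⟩⟩
  have h2 := h1 m le_rfl
  rw [htop, AddSubgroup.card_top, Nat.card_eq_fintype_card, Fintype.card_fun] at h2
  have hbot : chainSub L m ≠ ⊥ := by
    intro h
    rw [h, AddSubgroup.card_bot, one_mul] at h2
    exact absurd h2 (not_le.mpr (Nat.pow_lt_pow_right Fintype.one_lt_card hcount))
  by_contra! hcon
  refine hbot ((AddSubgroup.eq_bot_iff_forall _).mpr fun c hc => ?_)
  by_contra hc0
  obtain ⟨x, hx0, hx⟩ := hc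
  exact hcon c hc0 x hx0 hx

end Chain

section Vanishing

variable {F : Type*} [Field F] {P : F[X][X]}

/-- Exponents `(j, i)` of the monomials `t ^ i * y ^ j` of degree at most `e`, reduced modulo a
monic equation of degree `n`. -/
def pairSet (n e : ℕ) : Finset (ℕ × ℕ) :=
  (Finset.range n ×ˢ Finset.range (e + 1)).filter fun p => p.1 + p.2 ≤ e

/-- The monomial with exponents `(j, i)` in the coordinate ring. -/
noncomputable def mono (P : F[X][X]) (p : ℕ × ℕ) : AdjoinRoot P := tR P ^ p.2 * yR P ^ p.1

/-- The linear combination of the monomials of degree at most `e` with given coefficients. -/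
noncomputable def comb (P : F[X][X]) (e : ℕ) (c : pairSet P.natDegree e → F) : AdjoinRoot P :=
  ∑ u, scal P (c u) * mono P u

theorem coord_comb (hP : P.Monic) (e : ℕ) (c : pairSet P.natDegree e → F) :
    AdjoinRoot.modByMonicHom hP (comb P e c) = ∑ u, monomial u.1.1 (monomial u.1.2 (c u)) := by
  have : comb P e c = AdjoinRoot.mk P (∑ u, monomial u.1.1 (monomial u.1.2 (c u))) := by
    rw [comb, map_sum]
    refine Finset.sum_congr rfl fun u _ => ?_
    rw [← C_mul_X_pow_eq_monomial, map_mul, map_pow, AdjoinRoot.mk_C, AdjoinRoot.mk_X,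
      ← C_mul_X_pow_eq_monomial, map_mul, map_pow, mono, mul_assoc]
    rfl
  rw [this]
  apply coord_mk_of_natDegree_lt
  rw [degree_eq_natDegree hP.ne_zero]
  refine (degree_sum_le _ _).trans_lt ?_
  rw [Finset.sup_lt_iff (WithBot.bot_lt_coe _)]
  intro u _
  refine (degree_monomial_le _ _).trans_lt ?_
  have := (Finset.mem_product.mp (Finset.mem_filter.mp u.2).1).1
  exact_mod_cast Finset.mem_range.mp this

theorem coord_comb_coeff (hP : P.Monic) {e : ℕ} (c : pairSet P.natDegree e → F)
    (u : pairSet P.natDegree e) :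
    ((AdjoinRoot.modByMonicHom hP (comb P e c)).coeff u.1.1).coeff u.1.2 = c u := by
  rw [coord_comb, finsetSum_coeff, finsetSum_coeff, Finset.sum_eq_single u]
  · simp
  · intro v _ hv
    rw [coeff_monomial]
    split_ifs with h1
    · rw [coeff_monomial, if_neg]
      exact fun h2 => hv (Subtype.ext (Prod.ext h1 h2))
    · simp
  · simp

theorem comb_injective (hP : P.Monic) (e : ℕ) : Function.Injective (comb P e) := by
  intro c c' h
  funext u
  rw [← coord_comb_coeff hP c, ← coord_comb_coeff hP c', h]

variable (hP : P.Monic) (htd : ∀ i j : ℕ, P.natDegree < i + j → (P.coeff j).coeff i = 0)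

include htd in
theorem mono_mem_curveFil {e : ℕ} {p : ℕ × ℕ} (hp : p.1 + p.2 ≤ e) :
    mono P p ∈ curveFil hP e := by
  have := t_pow_mul_mem_curveFil hP
    (y_pow_mul_mem_curveFil hP htd (one_mem_curveFil hP) p.1) p.2
  rw [mul_one] at this
  exact curveFil_mono hP (by omega) this

theorem sum_le_of_mem_pairSet {n e : ℕ} (u : pairSet n e) : u.1.1 + u.1.2 ≤ e :=
  (Finset.mem_filter.mp u.2).2

include htd in
theorem comb_mem_curveFil (e : ℕ) (c : pairSet P.natDegree e → F) :
    comb P e c ∈ curveFil hP e :=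
  sum_mem fun u _ => scalar_mul_mem_curveFil hP _
    (mono_mem_curveFil hP htd (sum_le_of_mem_pairSet u))

/-- The function on the product of the curve with itself with given coefficients. -/
noncomputable def biComb (P : F[X][X]) (a b : ℕ) :
    (pairSet P.natDegree a × pairSet P.natDegree b → F) →+ AdjoinRoot (prodPoly P) where
  toFun c := ∑ v, fstR P (comb P a fun u => c (u, v)) * (t₂ P ^ v.1.2 * y₂ P ^ v.1.1)
  map_zero' := by simp [comb]
  map_add' c c' := by
    simp only [comb, Pi.add_apply, map_add, add_mul, Finset.sum_add_distrib]

include htd in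
theorem biComb_mem (a b : ℕ) (c) : biComb P a b c ∈ biFil hP a b := by
  refine sum_mem fun v _ => ?_
  refine fst_mul_mem_biFil hP (a := 0) (fun s hs => ?_) ?_
  · simpa using mul_mem_curveFil hP htd (comb_mem_curveFil hP htd a _) hs
  · have h1 : ∀ j : ℕ, y₂ P ^ j ∈ biFil hP 0 j := by
      intro j
      induction j with
      | zero => simpa using one_mem_biFil hP
      | succ j ih => rw [pow_succ']; exact_mod_cast y₂_mul_mem_biFil hP htd ih
    have h2 : ∀ i j : ℕ, t₂ P ^ i * y₂ P ^ j ∈ biFil hP 0 (j + i : ℕ) := by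
      intro i j
      induction i with
      | zero => simpa using h1 j
      | succ i ih =>
        rw [pow_succ', mul_assoc, ← add_assoc]; exact_mod_cast t₂_mul_mem_biFil hP ih
    exact biFil_mono hP le_rfl (by exact_mod_cast sum_le_of_mem_pairSet v) (h2 _ _)

variable [Fintype F]

/-- The Frobenius endomorphism of the coordinate ring. -/
noncomputable abbrev frobR (P : F[X][X]) : AdjoinRoot P →+* AdjoinRoot P :=
  (FiniteField.frobeniusAlgHom F (AdjoinRoot P) : AdjoinRoot P →+* AdjoinRoot P)

theorem frobR_apply (x : AdjoinRoot P) : frobR P x = x ^ Fintype.card F := rfl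

theorem scal_pow_card (c : F) : scal P c ^ Fintype.card F = scal P c := by
  rw [← map_pow, FiniteField.pow_card]

theorem eval₂_graph :
    (prodPoly P).eval₂ (eval₂RingHom (frobR P) (tR P)) (yR P) = 0 := by
  rw [prodPoly, eval₂_map]
  have : (eval₂RingHom (frobR P) (tR P)).comp (mapRingHom (scal P)) = AdjoinRoot.of P := by
    ext c
    · simp only [RingHom.comp_apply, coe_mapRingHom, map_C, coe_eval₂RingHom, eval₂_C]
      rw [frobR_apply, ← RingHom.comp_apply, scal_pow_card]
    · simp
  rw [this, AdjoinRoot.eval₂_root]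

/-- Restriction to the graph of Frobenius. -/
noncomputable def graphR (P : F[X][X]) : AdjoinRoot (prodPoly P) →+* AdjoinRoot P :=
  AdjoinRoot.lift _ _ (eval₂_graph (P := P))

theorem graphR_fst (r : AdjoinRoot P) : graphR P (fstR P r) = r ^ Fintype.card F := by
  simp only [graphR, RingHom.comp_apply, AdjoinRoot.lift_of, coe_eval₂RingHom, eval₂_C]
  rfl

theorem graphR_t₂ : graphR P (t₂ P) = tR P := by simp [graphR]

theorem graphR_y₂ : graphR P (y₂ P) = yR P := by simp [graphR]

theorem graphR_biComb (a b : ℕ) (c) : graphR P (biComb P a b c) =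
    ∑ v : pairSet P.natDegree b, (comb P a fun u => c (u, v)) ^ Fintype.card F * mono P v := by
  simp only [biComb, AddMonoidHom.coe_mk, ZeroHom.coe_mk, map_sum, map_mul, map_pow, graphR_fst,
    graphR_t₂, graphR_y₂, mono]

include htd in
theorem graphR_biComb_mem (a b : ℕ) (c) :
    graphR P (biComb P a b c) ∈ curveFil hP (Fintype.card F * a + b : ℕ) := by
  rw [graphR_biComb]
  refine sum_mem fun v _ => ?_
  push_cast
  exact mul_mem_curveFil hP htd (pow_mem_curveFil hP htd (comb_mem_curveFil hP htd a _) _)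
    (mono_mem_curveFil hP htd (sum_le_of_mem_pairSet v))

theorem prod_X_sub_C_univ (F : Type*) [Field F] [Fintype F] :
    ∏ a : F, (X - C a) = X ^ Fintype.card F - X := by
  have hm : (X ^ Fintype.card F - X : F[X]).Monic := by
    apply monic_X_pow_sub
    rw [degree_X]
    exact_mod_cast Fintype.one_lt_card
  have := prod_multiset_X_sub_C_of_monic_of_roots_card_eq hm (by
    rw [FiniteField.roots_X_pow_card_sub_X, FiniteField.X_pow_card_sub_X_natDegree_eq _
      Fintype.one_lt_card]
    rfl)
  rw [FiniteField.roots_X_pow_card_sub_X] at this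
  exact this

theorem isCoprime_of_no_point {t₀ : F} (h : ∀ y₀, P.evalEval t₀ y₀ ≠ 0) :
    IsCoprime (AdjoinRoot.of P (X - C t₀)) (yR P - yR P ^ Fintype.card F) := by
  have h1 : IsCoprime (P.map (evalRingHom t₀)) (X ^ Fintype.card F - X) := by
    rw [← prod_X_sub_C_univ]
    refine IsCoprime.prod_right fun y _ => ?_
    refine IsCoprime.symm ((prime_X_sub_C y).irreducible.coprime_iff_not_dvd.mpr ?_)
    rw [dvd_iff_isRoot, IsRoot, map_evalRingHom_eval]
    exact h y
  obtain ⟨A, A', hA⟩ := h1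
  have hdvd : AdjoinRoot.of P (X - C t₀) ∣
      ((P.map (evalRingHom t₀)).map (scal P)).eval (yR P) := by
    have h2 : C (X - C t₀) ∣ (P.map (evalRingHom t₀)).map C - P := by
      rw [C_dvd_iff_dvd_coeff]
      intro i
      rw [dvd_iff_isRoot, IsRoot]
      simp
    have h3 := map_dvd (AdjoinRoot.mk P) h2
    rw [map_sub (AdjoinRoot.mk P) (map C _), AdjoinRoot.mk_self, sub_zero, AdjoinRoot.mk_C, ← AdjoinRoot.aeval_eq, aeval_def,
      eval₂_map, AdjoinRoot.algebraMap_eq, ← eval_map] at h3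
    exact h3
  obtain ⟨w, hw⟩ := hdvd
  have h4 := congrArg (fun f => (f.map (scal P)).eval (yR P)) hA
  simp only [Polynomial.map_add, Polynomial.map_mul, eval_add, eval_mul, hw, Polynomial.map_sub,
    Polynomial.map_pow, map_X, eval_sub, eval_pow, eval_X, Polynomial.map_one, eval_one] at h4
  refine ⟨(A.map (scal P)).eval (yR P) * w, -(A'.map (scal P)).eval (yR P), ?_⟩
  rw [← h4]
  ring

include hP in
theorem eq_zero_of_no_point {u : F[X]} (hu : u ≠ 0)
    (hno : ∀ t₀ y₀, u.eval t₀ ≠ 0 → P.evalEval t₀ y₀ ≠ 0) {B m : ℕ} {θ z : AdjoinRoot P}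
    (hθ : θ ∈ curveFil hP B) (hB : B + m * u.natDegree < m * Fintype.card F)
    (hz : (yR P - yR P ^ Fintype.card F) ^ m * θ = (tR P - tR P ^ Fintype.card F) ^ m * z) :
    θ = 0 := by
  classical
  set s := Finset.univ.filter fun t₀ : F => u.eval t₀ ≠ 0 with hs
  set D : F[X] := ∏ t₀ ∈ s, (X - C t₀) with hD
  have hDdvd : D ∣ X - X ^ Fintype.card F := by
    rw [dvd_sub_comm]
    rw [← prod_X_sub_C_univ]
    exact Finset.prod_dvd_prod_of_subset s Finset.univ _ (Finset.subset_univ _)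
  have hDm : D.Monic := monic_prod_of_monic _ _ fun t₀ _ => monic_X_sub_C t₀
  have hDdeg : Fintype.card F ≤ D.natDegree + u.natDegree := by
    rw [hD, natDegree_prod_of_monic _ _ fun t₀ _ => monic_X_sub_C t₀]
    simp only [natDegree_X_sub_C, Finset.sum_const, smul_eq_mul, mul_one]
    rw [← Finset.card_univ, ← Finset.card_filter_add_card_filter_not (s := Finset.univ) (fun t₀ : F => u.eval t₀ ≠ 0)]
    refine Nat.add_le_add_left ?_ _
    refine le_trans ?_ (u.card_roots')
    refine le_trans (Finset.card_le_card ?_) (Multiset.toFinset_card_le _)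
    intro t₀ ht₀
    simpa [hu] using ht₀
  have hcop : IsCoprime (AdjoinRoot.of P D) (yR P - yR P ^ Fintype.card F) := by
    rw [hD, map_prod]
    exact IsCoprime.prod_left fun t₀ ht₀ =>
      isCoprime_of_no_point fun y₀ => hno t₀ y₀ (Finset.mem_filter.mp ht₀).2
  have hdvd : AdjoinRoot.of P (D ^ m) ∣ θ := by
    rw [map_pow]
    refine (hcop.pow (m := m) (n := m)).dvd_of_dvd_mul_left ?_
    rw [hz]
    refine Dvd.dvd.mul_right (pow_dvd_pow_of_dvd ?_ m) z
    have := map_dvd (AdjoinRoot.of P) hDdvd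
    simpa using this
  obtain ⟨r, rfl⟩ := hdvd
  apply coord_injective hP
  rw [coord_of_mul, map_zero]
  ext1 j
  rw [coeff_C_mul, coeff_zero]
  by_contra hne
  have hr : (AdjoinRoot.modByMonicHom hP r).coeff j ≠ 0 := right_ne_zero_of_mul hne
  have h1 := hθ j
  rw [coord_of_mul, coeff_C_mul] at h1
  have h2 := (h1 (D ^ m * (AdjoinRoot.modByMonicHom hP r).coeff j).natDegree).2 ?_
  · exact hne (leadingCoeff_eq_zero.mp h2)
  · rw [(hDm.pow m).natDegree_mul' hr, hDm.natDegree_pow]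
    have : m * Fintype.card F ≤ m * D.natDegree + m * u.natDegree := by
      rw [← mul_add]; exact Nat.mul_le_mul_left _ hDdeg
    push_cast
    zify at this hB
    omega

include hP htd in
theorem graphR_biComb_eq_zero {u : F[X]} (hu : u ≠ 0)
    (hno : ∀ t₀ y₀, u.eval t₀ ≠ 0 → P.evalEval t₀ y₀ ≠ 0) {a b m : ℕ}
    (hB : Fintype.card F * a + b + m * u.natDegree < m * Fintype.card F) {c}
    {x : ℕ → AdjoinRoot (prodPoly P)} (hx0 : x 0 = biComb P a b c) (hx : IsChain P m x) :
    graphR P (biComb P a b c) = 0 := by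
  refine eq_zero_of_no_point hP hu hno (graphR_biComb_mem hP htd a b c) hB
    (z := graphR P (x m)) ?_
  have := congrArg (graphR P) (hx.pow_mul_zero le_rfl)
  rw [map_mul, map_mul, map_pow, map_pow, map_sub, map_sub, graphR_fst, graphR_fst, graphR_t₂,
    graphR_y₂, hx0] at this
  exact this

end Vanishing

theorem card_filter_range_add_le (j e : ℕ) :
    ((Finset.range (e + 1)).filter fun i => j + i ≤ e).card = e + 1 - j := by
  rw [show (Finset.range (e + 1)).filter (fun i => j + i ≤ e) = Finset.range (e + 1 - j) by
    ext i; simp; omega]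
  simp

theorem card_pairSet_eq_sum (n e : ℕ) :
    (pairSet n e).card = ∑ j ∈ Finset.range n, (e + 1 - j) := by
  rw [pairSet, Finset.card_filter, Finset.sum_product]
  exact Finset.sum_congr rfl fun j _ => by rw [← Finset.card_filter, card_filter_range_add_le]

theorem card_triSet_eq_sum (n e : ℕ) :
    (triSet n e).card = ∑ j ∈ Finset.range n, ∑ l ∈ Finset.range (n - 1), (e + 1 - (j + l)) := by
  rw [triSet, Finset.card_filter, Finset.sum_product]
  refine Finset.sum_congr rfl fun j _ => ?_
  rw [Finset.sum_product]
  refine Finset.sum_congr rfl fun l _ => ?_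
  rw [← Finset.card_filter, ← card_filter_range_add_le (j + l) e]

theorem two_mul_sum_range_sub {n e : ℕ} (h : n ≤ e + 1) :
    (2 * (∑ j ∈ Finset.range n, (e + 1 - j) : ℕ) : ℤ) = n * (2 * e + 3 - n) := by
  induction n with
  | zero => simp
  | succ n ih =>
    rw [Finset.sum_range_succ]
    have h1 := ih (by omega)
    rw [Nat.cast_add, mul_add, h1]
    push_cast [show n ≤ e + 1 by omega]
    ring

theorem two_mul_card_pairSet {n e : ℕ} (h : n ≤ e + 1) :
    (2 * (pairSet n e).card : ℤ) = n * (2 * e + 3 - n) := by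
  rw [card_pairSet_eq_sum]; exact two_mul_sum_range_sub h

theorem two_mul_card_triSet {n e : ℕ} (hn : 1 ≤ n) (h : 2 * n ≤ e + 2) :
    (2 * (triSet n e).card : ℤ) = n * (n - 1) * (2 * e + 5 - 2 * n) := by
  have h1 : ∀ m ≤ n, (2 * (∑ j ∈ Finset.range m, ∑ l ∈ Finset.range (n - 1),
      (e + 1 - (j + l)) : ℕ) : ℤ) = m * (n - 1) * (2 * e + 5 - n - m) := by
    intro m hm
    induction m with
    | zero => simp
    | succ m ih =>
      have h2 := two_mul_sum_range_sub (n := n - 1) (e := e - m) (by omega)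
      have h3 : ∑ l ∈ Finset.range (n - 1), (e + 1 - (m + l)) =
          ∑ l ∈ Finset.range (n - 1), (e - m + 1 - l) :=
        Finset.sum_congr rfl fun l _ => by omega
      rw [Finset.sum_range_succ, h3]
      have h4 := ih (by omega)
      rw [Nat.cast_add, mul_add, h4, h2]
      push_cast [hn, show m ≤ e by omega]
      ring
  rw [card_triSet_eq_sum, h1 n le_rfl]
  ring

theorem count_lt {n d : ℕ} (hn : 1 ≤ n) (hnd : n ≤ d) :
    ∑ k ∈ Finset.range (n ^ 2), (triSet n (n ^ 2 - 1 + (d ^ 3 - 1) - k)).card <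
      (pairSet n (n ^ 2 - 1)).card * (pairSet n (d ^ 3 - 1)).card := by
  obtain ⟨b, hb⟩ : ∃ b, d ^ 3 = b + 1 := 
    ⟨d ^ 3 - 1, (Nat.sub_add_cancel (Nat.one_le_pow 3 d (by omega))).symm⟩
  have hb' : n ^ 3 ≤ b + 1 := hb ▸ Nat.pow_le_pow_left hnd 3
  have hn2 : n ≤ n ^ 2 := Nat.le_self_pow two_ne_zero n
  have hn3 : 2 * n ≤ n ^ 3 + 1 := by
    rcases hn.eq_or_lt with rfl | h
    · norm_num
    · have h4 : 4 ≤ n ^ 2 := by nlinarith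
      nlinarith
  rw [hb, Nat.add_sub_cancel]
  obtain ⟨a, ha⟩ : ∃ a, n ^ 2 = a + 1 := ⟨n ^ 2 - 1, by omega⟩
  rw [ha, Nat.add_sub_cancel]
  have hsum : ∀ m ≤ a + 1, (2 * (∑ k ∈ Finset.range m, (triSet n (a + b - k)).card : ℕ) : ℤ) =
      n * (n - 1) * (m * (2 * (a + b) + 6 - 2 * n - m)) := by
    intro m hm
    induction m with
    | zero => simp
    | succ m ih =>
      rw [Finset.sum_range_succ, Nat.cast_add, mul_add, ih (by omega),
        two_mul_card_triSet hn (by omega)]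
      push_cast [show m ≤ a + b by omega]
      ring
  have e1 := hsum (a + 1) le_rfl
  have e2 := two_mul_card_pairSet (n := n) (e := a) (by omega)
  have e3 := two_mul_card_pairSet (n := n) (e := b) (by nlinarith)
  zify at *
  set s := ∑ k ∈ Finset.range (a + 1), ((triSet n (a + b - k)).card : ℤ)
  have ha' : (a : ℤ) = n ^ 2 - 1 := by linarith
  rw [ha'] at e1 e2
  have key : (4 : ℤ) * s < (2 * (pairSet n a).card) * (2 * (pairSet n b).card) := by
    rw [e2, e3, show (4 : ℤ) * s = 2 * (2 * s) by ring, e1, ← sub_pos]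
    have : (n : ℤ) * (2 * (n ^ 2 - 1) + 3 - n) * (n * (2 * b + 3 - n)) -
      2 * (n * (n - 1) * ((n ^ 2 - 1 + 1) * (2 * (n ^ 2 - 1 + b) + 6 - 2 * n - (n ^ 2 - 1 + 1)))) =
      n ^ 2 * ((2 * n + 2) * (b + 1 - n ^ 3) + (6 * n ^ 3 - 5 * n ^ 2 + 2 * n + 1)) := by ring
    rw [this]
    have h1 : (0 : ℤ) ≤ (2 * n + 2) * (b + 1 - n ^ 3) := mul_nonneg (by positivity) (by linarith)
    have h2 : (0 : ℤ) < 6 * n ^ 3 - 5 * n ^ 2 + 2 * n + 1 := by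
      have : (0 : ℤ) ≤ n ^ 2 * (n - 1) := mul_nonneg (by positivity) (by linarith)
      nlinarith
    positivity
  linarith

/-- Hensel's lemma over an adically complete ring, for polynomials that need not be monic. -/
theorem exists_root_of_adic {R : Type*} [CommRing R] (I : Ideal R) [IsAdicComplete I R] (f : R[X])
    (a₀ u : R) (h₀ : f.eval a₀ ∈ I) (hu : IsUnit u) (h₁ : 1 - u * f.derivative.eval a₀ ∈ I) :
    ∃ a, f.eval a = 0 ∧ a - a₀ ∈ I := by
  let T : R → R := fun x => x - u * f.eval x
  have hT : ∀ x y, x - a₀ ∈ I → y - a₀ ∈ I → ∃ s ∈ I, T x - T y = s * (x - y) := by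
    intro x y hx hy
    obtain ⟨c, hc⟩ := f.binomExpansion y (x - y)
    rw [add_sub_cancel] at hc
    obtain ⟨e, he⟩ := f.derivative.evalSubFactor y a₀
    refine ⟨1 - u * (f.derivative.eval y + c * (x - y)), ?_, ?_⟩
    · have hxy : x - y ∈ I := by simpa using I.sub_mem hx hy
      have : 1 - u * (f.derivative.eval y + c * (x - y)) =
          (1 - u * f.derivative.eval a₀) - u * (e * (y - a₀)) - u * c * (x - y) := by
        rw [← he]; ring
      rw [this]
      exact I.sub_mem (I.sub_mem h₁ (I.mul_mem_left _ (I.mul_mem_left _ hy)))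
        (I.mul_mem_left _ hxy)
    · simp only [T, hc]; ring
  let c : ℕ → R := fun n => T^[n] a₀
  have hc : ∀ n, c (n + 1) = T (c n) := fun n => Function.iterate_succ_apply' T n a₀
  have hcI : ∀ n, c n - a₀ ∈ I ∧ c (n + 1) - c n ∈ I ^ (n + 1) := by
    intro n
    induction n with
    | zero =>
      refine ⟨by simp [c], ?_⟩
      rw [hc]
      simp only [c, T, Function.iterate_zero, id, zero_add, pow_one]
      rw [sub_right_comm, sub_self, zero_sub]
      exact I.neg_mem (I.mul_mem_left _ h₀)
    | succ n ih =>
      have h2 : c (n + 1) - a₀ ∈ I := by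
        have := I.add_mem (Ideal.pow_le_self (by omega) ih.2) ih.1
        simpa using this
      refine ⟨h2, ?_⟩
      obtain ⟨s, hs, hss⟩ := hT _ _ h2 ih.1
      rw [← hc, ← hc] at hss
      rw [pow_succ', hss]
      exact Ideal.mul_mem_mul hs ih.2
  have aux : ∀ m n, m ≤ n → c m ≡ c n [SMOD (I ^ m • ⊤ : Ideal R)] := by
    intro m n hmn
    rw [← Ideal.one_eq_top, Ideal.smul_eq_mul, mul_one]
    obtain ⟨k, rfl⟩ := Nat.exists_eq_add_of_le hmn
    induction k with
    | zero => rw [add_zero]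
    | succ k ih =>
      refine (ih (by omega)).trans (SModEq.symm (SModEq.sub_mem.mpr ?_))
      exact Ideal.pow_le_pow_right (by omega) (hcI (m + k)).2
  obtain ⟨a, ha⟩ := IsPrecomplete.prec' c (aux _ _)
  have ha' : ∀ n, c n - a ∈ I ^ n := by
    intro n
    have := ha n
    rw [← Ideal.one_eq_top, Ideal.smul_eq_mul, mul_one] at this
    exact SModEq.sub_mem.mp this
  have haI : a - a₀ ∈ I := by
    have h1 := ha' 1
    rw [pow_one] at h1
    simpa using I.sub_mem (hcI 1).1 h1
  refine ⟨a, ?_, haI⟩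
  suffices h : u * f.eval a = 0 by exact (hu.mul_right_eq_zero).mp h
  refine IsHausdorff.haus' (I := I) _ fun n => ?_
  rw [← Ideal.one_eq_top, Ideal.smul_eq_mul, mul_one, SModEq.zero]
  have : u * f.eval a = (T (c n) - T a) - (c (n + 1) - c n) - (c n - a) := by
    rw [hc]; simp only [T]; ring
  rw [this]
  obtain ⟨s, hs, hss⟩ := hT _ _ (hcI n).1 haI
  rw [hss]
  exact (I ^ n).sub_mem ((I ^ n).sub_mem (Ideal.mul_mem_left _ _ (ha' n))
    (Ideal.pow_le_pow_right (by omega) (hcI n).2)) (ha' n)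

theorem exists_powerSeries_root {k : Type*} [Field k] (f : (PowerSeries k)[X]) (a₀ : k)
    (h₀ : (f.map PowerSeries.constantCoeff).eval a₀ = 0)
    (h₁ : (f.map PowerSeries.constantCoeff).derivative.eval a₀ ≠ 0) :
    ∃ a : PowerSeries k, f.eval a = 0 ∧ PowerSeries.constantCoeff a = a₀ := by
  have hI : ∀ x : PowerSeries k, x ∈ Ideal.span {(PowerSeries.X : PowerSeries k)} ↔
      PowerSeries.constantCoeff x = 0 := fun x => by
    rw [Ideal.mem_span_singleton, PowerSeries.X_dvd_iff]
  have hev : ∀ g : (PowerSeries k)[X], PowerSeries.constantCoeff (g.eval (PowerSeries.C a₀)) =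
      (g.map PowerSeries.constantCoeff).eval a₀ := fun g => by
    rw [← eval_map_apply, PowerSeries.constantCoeff_C]
  obtain ⟨a, ha, ha'⟩ := exists_root_of_adic (Ideal.span {PowerSeries.X}) f (PowerSeries.C a₀)
    (PowerSeries.C ((f.map PowerSeries.constantCoeff).derivative.eval a₀)⁻¹)
    (by rw [hI, hev, h₀]) ((isUnit_iff_ne_zero.mpr (inv_ne_zero h₁)).map _)
    (by
      rw [hI, map_sub, map_mul, hev, ← derivative_map, map_one, PowerSeries.constantCoeff_C,
        inv_mul_cancel₀ h₁, sub_self])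
  refine ⟨a, ha, ?_⟩
  rw [hI, map_sub, sub_eq_zero] at ha'
  simpa using ha'

section Smooth

/-- The partial derivative with respect to the first coordinate. -/
noncomputable def derivT {R : Type*} [CommRing R] (P : R[X][X]) : R[X][X] :=
  ∑ j ∈ Finset.range (P.natDegree + 1), monomial j (derivative (P.coeff j))

theorem coeff_derivT {R : Type*} [CommRing R] (P : R[X][X]) (j : ℕ) :
    (derivT P).coeff j = derivative (P.coeff j) := by
  simp only [derivT, finsetSum_coeff, coeff_monomial, Finset.sum_ite_eq', Finset.mem_range]
  split_ifs with h
  · rfl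
  · rw [coeff_eq_zero_of_natDegree_lt (by omega), derivative_zero]

theorem derivative_eval_C {R : Type*} [CommRing R] (P : R[X][X]) (y : R) :
    derivative (P.eval (C y)) = (derivT P).eval (C y) := by
  rw [derivT, eval_finsetSum, eval_eq_sum_range, derivative_sum]
  refine Finset.sum_congr rfl fun j _ => ?_
  rw [← C_pow, derivative_mul, derivative_C, mul_zero, add_zero, eval_monomial, C_pow]

theorem degree_derivT_lt {R : Type*} [CommRing R] [Nontrivial R] {P : R[X][X]} (hP : P.Monic) :
    (derivT P).degree < P.degree := by
  rw [degree_eq_natDegree hP.ne_zero, degree_lt_iff_coeff_zero]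
  intro j hj
  rw [coeff_derivT]
  rcases hj.eq_or_lt with rfl | hj
  · rw [hP.coeff_natDegree, derivative_one]
  · rw [coeff_eq_zero_of_natDegree_lt hj, derivative_zero]

/-- A bivariate polynomial over a perfect field of characteristic two with vanishing partial
derivatives is a square. -/
theorem exists_sq_of_derivatives_eq_zero {k : Type*} [Field k] [CharP k 2] [PerfectRing k 2]
    {P : k[X][X]} (h₁ : derivative P = 0) (h₂ : derivT P = 0) : ∃ Q : k[X][X], P = Q ^ 2 := by
  have hs : ∀ g : k[X], derivative g = 0 → ∃ s : k[X], s ^ 2 = g := by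
    intro g hg
    refine ⟨(contract 2 g).map (frobeniusEquiv k 2).symm, ?_⟩
    rw [← map_frobenius_expand, ← map_expand, map_map, expand_contract 2 hg (by norm_num)]
    have : (frobenius k 2).comp ((frobeniusEquiv k 2).symm : k →+* k) = RingHom.id k := by
      ext x
      simp
    rw [this, Polynomial.map_id]
  have hP := expand_contract 2 h₁ (by norm_num)
  choose s hs' using fun j => hs ((contract 2 P).coeff j) (by
    rw [coeff_contract (by norm_num), ← coeff_derivT, h₂, coeff_zero])
  refine ⟨∑ j ∈ Finset.range ((contract 2 P).natDegree + 1), monomial j (s j), ?_⟩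
  rw [sum_pow_char]
  conv_lhs => rw [← hP, (contract 2 P).as_sum_range, map_sum]
  refine Finset.sum_congr rfl fun j _ => ?_
  rw [expand_monomial, monomial_pow, hs', mul_comm]

theorem eval₂_C_add_X_injective {k : Type*} [Field k] (a : k) {r : k[X]}
    (h : r.eval₂ PowerSeries.C (PowerSeries.C a + PowerSeries.X) = 0) : r = 0 := by
  have h1 : ((r.comp (C a + X) : k[X]) : PowerSeries k) = 0 := by
    rw [← h, comp, ← Polynomial.coeToPowerSeries.ringHom_apply, hom_eval₂]
    congr 1
    · ext x : 1
      simp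
    · simp
  have h2 : r.comp (C a + X) = 0 := by
    rwa [← Polynomial.coe_zero, Polynomial.coe_inj] at h1
  rw [comp_eq_zero_iff] at h2
  rcases h2 with h2 | h2
  · exact h2
  · have := congrArg (fun p => coeff p 1) h2.2
    simp [coeff_C] at this

/-- An injective power series parametrization of an irreducible plane curve near a smooth point. -/
theorem exists_smooth_branch {k : Type*} [Field k] [IsAlgClosed k] [CharP k 2] {P : k[X][X]}
    (hP : P.Monic) (hirr : Irreducible P)
    (htd : ∀ i j : ℕ, P.natDegree < i + j → (P.coeff j).coeff i = 0) :
    ∃ φ : AdjoinRoot P →+* PowerSeries k, Function.Injective φ ∧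
      (∀ c, φ (scal P c) = PowerSeries.C c) ∧ ∃ l ∈ curveFil hP 1, φ l = PowerSeries.X := by
  have hdom : IsDomain (AdjoinRoot P) := AdjoinRoot.isDomain_of_prime hirr.prime
  have hintg : Algebra.IsIntegral k[X] (AdjoinRoot P) :=
    have := hP.finite_adjoinRoot
    Algebra.IsIntegral.of_finite _ _
  have hdvd : ∀ s : AdjoinRoot P, s ≠ 0 → ∃ r : k[X], r ≠ 0 ∧ s ∣ AdjoinRoot.of P r := by
    intro s hs
    exact (hintg.1 s).isAlgebraic.exists_nonzero_dvd (mem_nonZeroDivisors_of_ne_zero hs)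
  have hn : P.natDegree ≠ 0 := by
    intro h0
    rw [hP.natDegree_eq_zero.mp h0] at hirr
    exact not_irreducible_one hirr
  have hpoint : ∀ g : k[X][X], g ≠ 0 → g.degree < P.degree →
      ∃ t₀ y₀, P.evalEval t₀ y₀ = 0 ∧ g.evalEval t₀ y₀ ≠ 0 := by
    intro g hg hgd
    obtain ⟨r, hr, hgr⟩ := hdvd (AdjoinRoot.mk P g) (AdjoinRoot.mk_ne_zero_of_degree_lt hP hg hgd)
    obtain ⟨t₀, ht₀⟩ := r.exists_eval_ne_zero_of_natDegree_lt_card hr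
      ((Cardinal.natCast_lt_aleph0).trans_le (Cardinal.aleph0_le_mk k))
    obtain ⟨y₀, hy₀⟩ := IsAlgClosed.exists_root (P.map (evalRingHom t₀)) (by
      rw [hP.degree_map, degree_eq_natDegree hP.ne_zero]
      exact_mod_cast hn)
    rw [IsRoot, map_evalRingHom_eval] at hy₀
    refine ⟨t₀, y₀, hy₀, fun h => ht₀ ?_⟩
    have h1 := map_dvd (AdjoinRoot.evalEval hy₀) hgr
    rw [AdjoinRoot.evalEval_mk, h, zero_dvd_iff, ← AdjoinRoot.mk_C, AdjoinRoot.evalEval_mk] at h1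
    simpa [evalEval_C] using h1
  have hφ : ∀ τ υ : PowerSeries k,
      (h : P.eval₂ (eval₂RingHom PowerSeries.C τ) υ = 0) →
      (∀ r : k[X], r ≠ 0 → r.eval₂ PowerSeries.C τ ≠ 0) →
      Function.Injective (AdjoinRoot.lift _ _ h) := by
    intro τ υ h hr
    rw [injective_iff_map_eq_zero]
    intro s hs
    by_contra hs0
    obtain ⟨r, hr0, hsr⟩ := hdvd s hs0
    have := map_dvd (AdjoinRoot.lift _ _ h) hsr
    rw [hs, zero_dvd_iff, AdjoinRoot.lift_of] at this
    exact hr r hr0 this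
  by_cases hg : derivative P = 0
  · have hg₂ : derivT P ≠ 0 := by
      intro h
      obtain ⟨Q, rfl⟩ := exists_sq_of_derivatives_eq_zero hg h
      exact not_irreducible_pow (by norm_num) hirr
    obtain ⟨t₀, y₀, h0, h1⟩ := hpoint _ hg₂ (degree_derivT_lt hP)
    set υ : PowerSeries k := PowerSeries.C y₀ + PowerSeries.X with hυ
    have hf : ((P.map (mapRingHom PowerSeries.C)).eval (C υ)).map PowerSeries.constantCoeff =
        P.eval (C y₀) := by
      rw [← coe_mapRingHom, ← eval_map_apply, Polynomial.map_map]
      have : (mapRingHom PowerSeries.constantCoeff).comp (mapRingHom PowerSeries.C) =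
          RingHom.id k[X] := by
        ext <;> simp
      rw [this, Polynomial.map_id]
      simp [hυ]
    obtain ⟨τ, hτ, hτ0⟩ := exists_powerSeries_root
      ((P.map (mapRingHom PowerSeries.C)).eval (C υ)) t₀ (by rw [hf]; exact h0)
      (by rw [hf, derivative_eval_C]; exact h1)
    have hτ' : P.eval₂ (eval₂RingHom PowerSeries.C τ) υ = 0 := by
      rw [eval₂_eval₂RingHom_apply]; exact hτ
    refine ⟨AdjoinRoot.lift _ _ hτ', hφ _ _ _ ?_, ?_, yR P - scal P y₀, ?_, ?_⟩
    · intro r hr h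
      rw [(IsAlgClosed.splits r).eq_prod_roots, eval₂_mul, eval₂_C, mul_eq_zero] at h
      rcases h with h | h
      · simp [hr] at h
      rw [← coe_eval₂RingHom, map_multiset_prod, Multiset.prod_eq_zero_iff, Multiset.mem_map] at h
      obtain ⟨_, h2, h3⟩ := h
      obtain ⟨a, -, rfl⟩ := Multiset.mem_map.mp h2
      have ha : τ = PowerSeries.C a := by simpa [sub_eq_zero] using h3
      refine (hP.map (evalRingHom a)).ne_zero (eval₂_C_add_X_injective y₀ ?_)
      rw [eval₂_map, ← hυ, ← hτ', ha]
      congr 1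
      ext <;> simp
    · intro c
      simp
    · refine sub_mem ?_ ?_
      · have := y_mul_mem_curveFil hP htd (one_mem_curveFil hP)
        simpa using this
      · have := scalar_mul_mem_curveFil hP y₀ (one_mem_curveFil hP)
        rw [mul_one] at this
        exact curveFil_mono hP (by norm_num) this
    · simp [hυ]
  · obtain ⟨t₀, y₀, h0, h1⟩ := hpoint _ hg (degree_derivative_lt hP.ne_zero)
    set τ : PowerSeries k := PowerSeries.C t₀ + PowerSeries.X with hτ
    have hf : (P.map (eval₂RingHom PowerSeries.C τ)).map PowerSeries.constantCoeff =
        P.map (evalRingHom t₀) := by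
      rw [Polynomial.map_map]
      congr 1
      ext <;> simp [hτ]
    obtain ⟨υ, hυ, hυ0⟩ := exists_powerSeries_root (P.map (eval₂RingHom PowerSeries.C τ)) y₀
      (by rw [hf, map_evalRingHom_eval]; exact h0)
      (by rw [hf, derivative_map, map_evalRingHom_eval]; exact h1)
    rw [eval_map] at hυ
    refine ⟨AdjoinRoot.lift _ _ hυ, hφ _ _ _ ?_, ?_, tR P - scal P t₀, ?_, ?_⟩
    · exact fun r hr h => hr (eval₂_C_add_X_injective t₀ h)
    · intro c
      simp
    · refine sub_mem ?_ ?_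
      · have := t_mul_mem_curveFil hP (one_mem_curveFil hP)
        simpa using this
      · have := scalar_mul_mem_curveFil hP t₀ (one_mem_curveFil hP)
        rw [mul_one] at this
        exact curveFil_mono hP (by norm_num) this
    · simp [hτ]

end Smooth

section Order

variable {k : Type*} [Field k] {P : k[X][X]}

theorem comb_add (e : ℕ) (c c' : pairSet P.natDegree e → k) :
    comb P e (c + c') = comb P e c + comb P e c' := by
  simp only [comb, Pi.add_apply, map_add, add_mul, Finset.sum_add_distrib]

theorem comb_smul (e : ℕ) (r : k) (c : pairSet P.natDegree e → k) :
    comb P e (r • c) = scal P r * comb P e c := by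
  simp only [comb, Pi.smul_apply, smul_eq_mul, map_mul, Finset.mul_sum, mul_assoc]

theorem comb_zero (e : ℕ) : comb P e 0 = 0 := by
  simp [comb]

variable (hP : P.Monic) (htd : ∀ i j : ℕ, P.natDegree < i + j → (P.coeff j).coeff i = 0)

theorem eq_zero_of_coord_eq_zero {e : ℕ} {x : AdjoinRoot P} (hx : x ∈ curveFil hP e)
    (h : ∀ u : pairSet P.natDegree e,
      ((AdjoinRoot.modByMonicHom hP x).coeff u.1.1).coeff u.1.2 = 0) : x = 0 := by
  apply coord_injective hP
  rw [map_zero]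
  ext j i
  rw [coeff_zero, coeff_zero]
  by_cases hu : (j, i) ∈ pairSet P.natDegree e
  · exact h ⟨_, hu⟩
  · by_cases hj : P.natDegree ≤ j
    · rw [coord_eq_zero_of_le hP x hj, coeff_zero]
    · refine (hx j i).2 ?_
      simp only [pairSet, Finset.mem_filter, Finset.mem_product, Finset.mem_range] at hu
      omega

/-- The map whose injectivity bounds the order of vanishing of `a` at a smooth point. -/
noncomputable def orderMap (l a : AdjoinRoot P) (N e e' : ℕ) :
    ((Fin N → k) × (pairSet P.natDegree e → k)) →ₗ[k] (pairSet P.natDegree e' → k) where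
  toFun p u := ((AdjoinRoot.modByMonicHom hP
    (∑ i, scal P (p.1 i) * l ^ (i : ℕ) + a * comb P e p.2)).coeff u.1.1).coeff u.1.2
  map_add' p p' := by
    funext u
    rw [Pi.add_apply, ← coeff_add, ← coeff_add, ← map_add]
    congr 3
    simp only [Prod.fst_add, Prod.snd_add, Pi.add_apply, map_add, add_mul, Finset.sum_add_distrib,
      comb_add, mul_add]
    ring
  map_smul' r p := by
    funext u
    rw [RingHom.id_apply, Pi.smul_apply, smul_eq_mul, ← coeff_C_mul, ← coeff_C_mul,
      ← coord_of_mul]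
    congr 3
    simp only [Prod.smul_fst, Prod.smul_snd, Pi.smul_apply, map_mul, smul_eq_mul, comb_smul,
      mul_add, Finset.mul_sum, mul_assoc]
    rw [mul_left_comm a]
    rfl

include hP htd in
theorem not_dvd_of_mem_curveFil [IsDomain (AdjoinRoot P)] (hn : 1 ≤ P.natDegree)
    {φ : AdjoinRoot P →+* PowerSeries k}
    (hφ : ∀ c, φ (scal P c) = PowerSeries.C c) {l : AdjoinRoot P}
    (hl : l ∈ curveFil hP 1) (hlX : φ l = PowerSeries.X) {b : ℕ} {a : AdjoinRoot P}
    (ha : a ∈ curveFil hP b) (ha0 : a ≠ 0) :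
    ¬ PowerSeries.X ^ (P.natDegree * b + 1) ∣ φ a := by
  rintro ⟨w, hw⟩
  set n := P.natDegree with hnn
  set e := n * b + n with he
  have hinj : Function.Injective (orderMap hP l a (n * b + 1) e (e + b)) := by
    rw [← LinearMap.ker_eq_bot, LinearMap.ker_eq_bot']
    rintro ⟨p, μ⟩ h
    have h0 : ∑ i, scal P (p i) * l ^ (i : ℕ) + a * comb P e μ = 0 := by
      refine eq_zero_of_coord_eq_zero hP (e := e + b) (add_mem (sum_mem fun i _ => ?_) ?_)
        fun u => congrFun h u
      · refine scalar_mul_mem_curveFil hP _ ?_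
        have h1 := pow_mem_curveFil hP htd (e := 1) (by exact_mod_cast hl) i
        refine curveFil_mono hP ?_ h1
        have := i.2
        push_cast
        nlinarith [this]
      · push_cast
        rw [add_comm]
        exact mul_mem_curveFil hP htd ha (comb_mem_curveFil hP htd e μ)
    have hp : p = 0 := by
      have h1 := congrArg φ h0
      simp only [map_add, map_sum, map_mul, map_pow, hφ, hlX, hw, map_zero] at h1
      funext i
      have h2 := congrArg (PowerSeries.coeff (i : ℕ)) h1
      rw [map_add, map_sum, mul_assoc, PowerSeries.coeff_X_pow_mul',
        if_neg (by omega), add_zero, map_zero] at h2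
      simpa [PowerSeries.coeff_C_mul, PowerSeries.coeff_X_pow, Fin.val_inj] using h2
    subst hp
    have hμ : comb P e μ = 0 := by
      simpa [ha0] using h0
    rw [Prod.mk_eq_zero]
    refine ⟨rfl, comb_injective hP e ?_⟩
    rw [hμ, comb_zero]
  have h1 := LinearMap.finrank_le_finrank_of_injective hinj
  rw [Module.finrank_prod, Module.finrank_fintype_fun_eq_card, Module.finrank_fintype_fun_eq_card,
    Module.finrank_fintype_fun_eq_card, Fintype.card_fin, Fintype.card_coe, Fintype.card_coe] at h1
  have h2 := two_mul_card_pairSet (n := n) (e := e) (by nlinarith)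
  have h3 := two_mul_card_pairSet (n := n) (e := e + b) (by nlinarith)
  zify at h1
  push_cast at h3
  nlinarith

include hP htd in
/-- The monomials of small degree are linearly independent over the `2 ^ s`-th powers of the
coordinate ring. -/
theorem eq_zero_of_sum_pow_mul_mono_eq_zero [IsAlgClosed k] [CharP k 2] (hirr : Irreducible P)
    {s b : ℕ} (hb : P.natDegree * b < 2 ^ s) (h : pairSet P.natDegree b → AdjoinRoot P)
    (h0 : ∑ v, h v ^ 2 ^ s * mono P v = 0) (v) : h v = 0 := by
  have hdom : IsDomain (AdjoinRoot P) := AdjoinRoot.isDomain_of_prime hirr.prime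
  have hn : 1 ≤ P.natDegree := by
    rw [Nat.one_le_iff_ne_zero]
    intro h0
    rw [hP.natDegree_eq_zero.mp h0] at hirr
    exact not_irreducible_one hirr
  obtain ⟨φ, hinj, hφ, l, hl, hlX⟩ := exists_smooth_branch hP hirr htd
  by_contra hv
  have hv' : φ (h v) ≠ 0 := (map_ne_zero_iff φ hinj).mpr hv
  have hex : ∃ i, ∃ v, ¬ PowerSeries.X ^ (i + 1) ∣ φ (h v) := by
    by_contra! hall
    refine hv' (PowerSeries.ext fun i => ?_)
    exact PowerSeries.X_pow_dvd_iff.mp (hall i v) i (by omega)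
  classical
  obtain ⟨v₁, hv₁⟩ := Nat.find_spec hex
  have hdvd : ∀ v, PowerSeries.X ^ Nat.find hex ∣ φ (h v) := by
    intro v
    rcases hi : Nat.find hex with _ | i
    · simp
    · have := Nat.find_min hex (m := i) (by omega)
      push Not at this
      exact this v
  choose g hg using hdvd
  set i := Nat.find hex with hi
  have hc : PowerSeries.constantCoeff (g v₁) ≠ 0 := by
    intro hc
    rw [← PowerSeries.X_dvd_iff] at hc
    apply hv₁
    rw [pow_succ, hg]
    exact mul_dvd_mul_left _ hc
  choose r hr using fun v => (PowerSeries.X_dvd_iff (φ := g v -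
    PowerSeries.C (PowerSeries.constantCoeff (g v)))).mpr (by simp)
  have hg' : ∀ v, g v = PowerSeries.C (PowerSeries.constantCoeff (g v)) +
    PowerSeries.X * r v := fun v => by rw [← hr]; ring
  have : CharP (PowerSeries k) 2 := charP_of_injective_ringHom (f := PowerSeries.C)
    (PowerSeries.C_injective) 2
  have hsum : ∑ v, g v ^ 2 ^ s * φ (mono P v) = 0 := by
    have h1 := congrArg φ h0
    simp only [map_sum, map_mul, map_pow, hg, mul_pow, map_zero, mul_assoc] at h1
    rw [← Finset.mul_sum] at h1
    exact (mul_eq_zero.mp h1).resolve_left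
      (pow_ne_zero _ (pow_ne_zero _ PowerSeries.X_ne_zero))
  refine not_dvd_of_mem_curveFil hP htd hn hφ hl hlX (comb_mem_curveFil hP htd b
    fun v => PowerSeries.constantCoeff (g v) ^ 2 ^ s) ?_
    ((pow_dvd_pow _ hb).trans ⟨- ∑ v, r v ^ 2 ^ s * φ (mono P v), ?_⟩)
  · intro h2
    rw [← comb_zero (P := P) b] at h2
    exact hc (pow_eq_zero_iff (by positivity) |>.mp (congrFun (comb_injective hP b h2) v₁))
  · rw [mul_neg, ← add_eq_zero_iff_eq_neg, Finset.mul_sum, comb, map_sum,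
      ← Finset.sum_add_distrib, ← hsum]
    refine Finset.sum_congr rfl fun v _ => ?_
    conv_rhs => rw [hg' v, add_pow_char_pow, mul_pow]
    rw [map_mul, hφ, map_pow]
    ring

end Order

section Points

variable {F : Type*} [Field F] {P : F[X][X]}

theorem eval₂_root_map {k : Type*} [Field k] (j : F →+* k) (P : F[X][X]) :
    P.eval₂ ((AdjoinRoot.of (P.map (mapRingHom j))).comp (mapRingHom j))
      (AdjoinRoot.root (P.map (mapRingHom j))) = 0 := by
  rw [← eval₂_map, AdjoinRoot.eval₂_root]

/-- Base change of the coordinate ring. -/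
noncomputable def baseChange {k : Type*} [Field k] (j : F →+* k) (P : F[X][X]) :
    AdjoinRoot P →+* AdjoinRoot (P.map (mapRingHom j)) :=
  AdjoinRoot.lift _ _ (eval₂_root_map j P)

theorem baseChange_mono {k : Type*} [Field k] (j : F →+* k) (v : ℕ × ℕ) :
    baseChange j P (mono P v) = mono (P.map (mapRingHom j)) v := by
  simp [baseChange, mono]

theorem baseChange_comb {k : Type*} [Field k] (j : F →+* k) {e : ℕ}
    (E : pairSet P.natDegree e ≃ pairSet (P.map (mapRingHom j)).natDegree e)
    (hE : ∀ u, (E u).1 = u.1) (c : pairSet P.natDegree e → F) :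
    baseChange j P (comb P e c) = comb (P.map (mapRingHom j)) e fun u => j (c (E.symm u)) := by
  rw [comb, comb, map_sum, ← E.sum_comp]
  refine Finset.sum_congr rfl fun u _ => ?_
  rw [map_mul, baseChange_mono, hE, E.symm_apply_apply]
  simp [baseChange]

/-- An absolutely irreducible plane curve over a finite field of characteristic two has a rational
point outside of a given divisor as soon as the field is large compared with the degrees. -/
theorem exists_point [Fintype F] {s : ℕ} (hcard : Fintype.card F = 2 ^ s)
    {k : Type*} [Field k] [IsAlgClosed k] (j : F →+* k) (hP : P.Monic)
    (htd : ∀ i j : ℕ, P.natDegree < i + j → (P.coeff j).coeff i = 0)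
    (hirr : Irreducible (P.map (mapRingHom j))) {d : ℕ} (hd : 3 ≤ d) (hnd : P.natDegree ≤ d)
    (hdq : d ^ 4 ≤ Fintype.card F) {u : F[X]} (hu : u ≠ 0) (hud : u.natDegree ≤ 2 * d) :
    ∃ t₀ y₀, u.eval t₀ ≠ 0 ∧ P.evalEval t₀ y₀ = 0 := by
  have hPk := hP.map (mapRingHom j)
  have hdeg : (P.map (mapRingHom j)).natDegree = P.natDegree := hP.natDegree_map _
  have hn : 1 ≤ P.natDegree := by
    rw [Nat.one_le_iff_ne_zero, ← hdeg]
    intro h0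
    rw [hPk.natDegree_eq_zero.mp h0] at hirr
    exact not_irreducible_one hirr
  have hs : s ≠ 0 := by
    rintro rfl
    have := Fintype.one_lt_card (α := F)
    omega
  have hF : CharP F 2 := by
    obtain ⟨p, hp⟩ := CharP.exists F
    have hpp : p.Prime := CharP.char_is_prime F p
    have : (p : ℕ) ∣ 2 ^ s := by
      rw [← hcard]
      exact (CharP.cast_eq_zero_iff F p _).mp (FiniteField.cast_card_eq_zero F)
    rw [(Nat.prime_dvd_prime_iff_eq hpp Nat.prime_two).mp (hpp.dvd_of_dvd_pow this)] at hp
    exact hp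
  have hk : CharP k 2 := charP_of_injective_ringHom j.injective 2
  by_contra! hno
  set n := P.natDegree with hnn
  have hn2 : n ^ 2 ≤ d ^ 2 := Nat.pow_le_pow_left hnd 2
  have hn1 : 1 ≤ n ^ 2 := Nat.one_le_pow _ _ hn
  have hd1 : 1 ≤ d ^ 3 := Nat.one_le_pow _ _ (by omega)
  obtain ⟨c, hc, x, hx0, hx⟩ := exists_chain hP htd
    (biComb P (n ^ 2 - 1) (d ^ 3 - 1)) hn (a := n ^ 2 - 1) (b := d ^ 3 - 1) (m := n ^ 2)
    (by omega) (biComb_mem hP htd _ _) (by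
      rw [Fintype.card_prod, Fintype.card_coe, Fintype.card_coe]
      exact count_lt hn hnd)
  have h0 := graphR_biComb_eq_zero hP htd hu hno (a := n ^ 2 - 1) (b := d ^ 3 - 1) (m := n ^ 2)
    (by
      have h1 : n ^ 2 * u.natDegree ≤ 2 * d ^ 3 := by nlinarith
      have h2 : Fintype.card F * (n ^ 2 - 1) + Fintype.card F = n ^ 2 * Fintype.card F := by
        rw [Nat.mul_sub, mul_comm (n ^ 2), mul_one]
        exact Nat.sub_add_cancel (Nat.le_mul_of_pos_right _ hn1)
      have h3 : 3 * d ^ 3 ≤ d ^ 4 := by rw [pow_succ d 3, mul_comm]; gcongr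
      omega) hx0 hx
  rw [graphR_biComb] at h0
  have E : ∀ e, ∃ E : pairSet n e ≃ pairSet (P.map (mapRingHom j)).natDegree e,
      ∀ u, (E u).1 = u.1 := fun e =>
    ⟨Equiv.subtypeEquivRight fun x => by rw [hdeg], fun u => rfl⟩
  obtain ⟨E₁, hE₁⟩ := E (n ^ 2 - 1)
  obtain ⟨E₂, hE₂⟩ := E (d ^ 3 - 1)
  have h1 := congrArg (baseChange j P) h0
  rw [map_zero, map_sum, ← E₂.symm.sum_comp] at h1
  have hE₂' : ∀ v, (E₂.symm v).1 = v.1 := fun v => by rw [← hE₂, E₂.apply_symm_apply]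
  simp only [map_mul, map_pow, baseChange_mono, baseChange_comb j E₁ hE₁, hcard, hE₂'] at h1
  have h2 := eq_zero_of_sum_pow_mul_mono_eq_zero hPk
    (fun i j h => by
      rw [hdeg] at h
      rw [coeff_map, coe_mapRingHom, coeff_map, htd _ _ h, map_zero]) hirr (by
      rw [hdeg, ← hcard]
      refine lt_of_lt_of_le ?_ hdq
      rw [pow_succ' d 3]
      exact Nat.mul_lt_mul_of_le_of_lt hnd (by omega) (by omega)) _ h1
  refine hc (funext fun ⟨v, w⟩ => ?_)
  have h3 := h2 (E₂ w)
  rw [← comb_zero] at h3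
  have h4 := congrFun (comb_injective hPk _ h3) (E₁ v)
  simpa using h4

end Points

theorem exists_irreducible_of_integral {A E : Type*} [CommRing A] [IsDomain A]
    [IsIntegrallyClosed A] [CommRing E] [IsDomain E] {τ : A →+* E} (hτ : Function.Injective τ)
    {x : E} {Q : A[X]} (hQ : Q.Monic) (hx : Q.eval₂ τ x = 0) :
    ∃ P : A[X], P.Monic ∧ Irreducible P ∧ P.eval₂ τ x = 0 ∧
      ∀ R : A[X], R.eval₂ τ x = 0 → P ∣ R := by
  let _ := τ.toAlgebra
  have : Module.IsTorsionFree A E := by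
    rw [Module.isTorsionFree_iff_algebraMap_injective]
    exact hτ
  have hi : IsIntegral A x := ⟨Q, hQ, hx⟩
  exact ⟨minpoly A x, minpoly.monic hi, minpoly.irreducible hi, minpoly.aeval A x,
    fun R hR => minpoly.isIntegrallyClosed_dvd hi hR⟩

theorem exists_eq_of_eval₂_eq_zero {k E : Type*} [Field k] [IsAlgClosed k] [CommRing E] [IsDomain E]
    (j : k →+* E) {p : k[X]} (hp : p ≠ 0) {x : E} (hx : p.eval₂ j x = 0) : ∃ a, x = j a := by
  rw [(IsAlgClosed.splits p).eq_prod_roots, eval₂_mul, eval₂_C, mul_eq_zero] at hx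
  rcases hx with hx | hx
  · rw [map_eq_zero_iff j j.injective, leadingCoeff_eq_zero] at hx
    exact absurd hx hp
  rw [← coe_eval₂RingHom, map_multiset_prod, Multiset.prod_eq_zero_iff, Multiset.mem_map] at hx
  obtain ⟨_, h2, h3⟩ := hx
  obtain ⟨a, -, rfl⟩ := Multiset.mem_map.mp h2
  exact ⟨a, by simpa [sub_eq_zero] using h3⟩

/-- A polynomial divisor over the algebraic closure whose class is stable under a semilinear
automorphism is defined over the fixed field. -/
theorem exists_map_eq_of_stable {F k E : Type*} [Field F] [Field k] [CommRing E]
    {i : F →+* k} {s : k →+* k} (hs : ∀ x, s x = x → x ∈ i.range)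
    {j : k →+* E} {σ : E →+* E} (hσ : ∀ x, σ (j x) = j (s x)) {t x : E} (ht : σ t = t)
    (hx : σ x = x) {P : k[X][X]} (hP : P.Monic) (hPx : P.eval₂ (eval₂RingHom j t) x = 0)
    (hmin : ∀ R : k[X][X], R.eval₂ (eval₂RingHom j t) x = 0 → P ∣ R) :
    ∃ P₀ : F[X][X], P₀.Monic ∧ P₀.map (mapRingHom i) = P := by
  have h1 : (P.map (mapRingHom s)).eval₂ (eval₂RingHom j t) x = 0 := by
    have h2 : (eval₂RingHom j t).comp (mapRingHom s) = σ.comp (eval₂RingHom j t) := by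
      ext <;> simp [hσ, ht]
    conv_lhs => rw [← hx]
    rw [eval₂_map, h2, ← hom_eval₂, hPx, map_zero]
  have h2 : P.map (mapRingHom s) = P :=
    (eq_of_monic_of_dvd_of_natDegree_le hP (hP.map _) (hmin _ h1)
      (natDegree_map_le)).symm ▸ rfl
  have h3 : P ∈ (mapRingHom (mapRingHom i)).range := by
    rw [mem_map_range]
    intro a
    rw [mem_map_range]
    intro b
    apply hs
    conv_rhs => rw [← h2]
    simp
  obtain ⟨P₀, rfl⟩ := h3
  exact ⟨P₀, monic_of_injective (map_injective i i.injective) hP, rfl⟩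

section Homogenization

variable {F : Type*} [Field F]

/-- Homogenization substitution: multiply both coordinates by a new variable. -/
noncomputable def homog : F[X][X] →+* F[X][X][X] :=
  eval₂RingHom (S := F[X][X][X])
    (eval₂RingHom (S := F[X][X][X]) (C.comp (C.comp C)) (C (C X) * X)) (C X * X)

theorem coeff_homog (P : F[X][X]) (m j i : ℕ) :
    (((homog P).coeff m).coeff j).coeff i = if i + j = m then (P.coeff j).coeff i else 0 := by
  induction P using Polynomial.induction_on' with
  | add p q hp hq => simp only [map_add, coeff_add, hp, hq]; split_ifs <;> simp
  | monomial b p =>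
    induction p using Polynomial.induction_on' with
    | add p q hp hq =>
      simp only [map_add, coeff_add, hp, hq]; split_ifs <;> simp
    | monomial a c =>
      have : homog (monomial b (monomial a c)) =
          monomial (a + b) (monomial b (monomial a c)) := by
        have h1 : homog (X : F[X][X]) = C X * X := by simp [homog]
        have h2 : homog (C X : F[X][X]) = C (C X) * X := by simp [homog]
        have h3 : homog (C (C c) : F[X][X]) = C (C (C c)) := by simp [homog]
        simp only [← C_mul_X_pow_eq_monomial, map_mul, map_pow, h1, h2, h3]
        ring
      rw [this]
      simp only [coeff_monomial]
      by_cases h2 : b = j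
      · by_cases h3 : a = i
        · subst h2 h3
          by_cases h1 : a + b = m <;> simp [h1]
        · split_ifs <;> simp [coeff_monomial, h2, h3]
      · split_ifs <;> simp [coeff_monomial, h2]

theorem coeff_eq_zero_of_mul {P Q : F[X][X]} (hP : P.Monic) {d : ℕ} {c : F} (hc : c ≠ 0)
    (hd : (P * Q).natDegree = d) (hl : (P * Q).leadingCoeff = C c)
    (hh : (homog (P * Q)).natDegree ≤ d) :
    ∀ i j : ℕ, P.natDegree < i + j → (P.coeff j).coeff i = 0 := by
  have hQ : Q.leadingCoeff = C c := by
    rwa [leadingCoeff_mul, hP.leadingCoeff, one_mul] at hl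
  have hQ0 : Q ≠ 0 := by
    rintro rfl
    exact hc (by simpa using hQ.symm)
  have h0 : ∀ (R : F[X][X]) (c : F), c ≠ 0 → R.leadingCoeff = C c →
      homog R ≠ 0 ∧ R.natDegree ≤ (homog R).natDegree := by
    intro R c hc hR
    have : (homog R).coeff R.natDegree ≠ 0 := by
      intro h
      have h1 := coeff_homog R R.natDegree R.natDegree 0
      rw [h, zero_add, if_pos rfl, coeff_natDegree, hR] at h1
      exact hc (by simpa using h1.symm)
    refine ⟨?_, le_natDegree_of_ne_zero this⟩
    rintro h
    rw [h] at this
    exact this rfl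
  obtain ⟨hP1, -⟩ := h0 P 1 one_ne_zero hP
  obtain ⟨hQ1, hQ2⟩ := h0 Q c hc hQ
  rw [map_mul, natDegree_mul hP1 hQ1] at hh
  rw [natDegree_mul hP.ne_zero hQ0] at hd
  intro i j hij
  have := coeff_homog P (i + j) j i
  rw [if_pos rfl] at this
  rw [← this, coeff_eq_zero_of_natDegree_lt (p := homog P) (by omega)]
  simp

end Homogenization

section Curve

variable {F : Type*} [Field F]

/-- The expression whose vanishing obstructs planarity in characteristic two. -/
noncomputable def planarForm {A : Type*} [CommRing A] (i : F →+* A) (g : F[X]) (x y : A) : A :=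
  g.eval₂ i x + g.eval₂ i y + g.eval₂ i (x + y) + x * y

/-- The plane curve attached to a polynomial, in coordinates adapted to the direction `β`. -/
noncomputable def planeCurve (g : F[X]) (β : F) : F[X][X] :=
  planarForm (C.comp C) g X (C (C β) * X + C X)

theorem natDegree_eval₂_linear_le (g : F[X]) (b : F) (c : F[X]) :
    (g.eval₂ (C.comp C) (C (C b) * X + C c)).natDegree ≤ g.natDegree := by
  rw [← eval₂_map, ← comp]
  refine natDegree_comp_le.trans ?_
  rw [natDegree_map]
  have := natDegree_linear_le (a := (C b : F[X])) (b := c)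
  nlinarith

theorem coeff_eval₂_linear (g : F[X]) {b : F} (hb : b ≠ 0) (c : F[X]) :
    (g.eval₂ (C.comp C) (C (C b) * X + C c)).coeff g.natDegree =
      C (g.leadingCoeff * b ^ g.natDegree) := by
  have hb' : (C b : F[X]) ≠ 0 := C_ne_zero.mpr hb
  have h1 := coeff_comp_degree_mul_degree (p := g.map C) (q := C (C b) * X + C c)
    (by rw [natDegree_linear hb']; exact one_ne_zero)
  rw [natDegree_linear hb', natDegree_map, mul_one, leadingCoeff_map, leadingCoeff_linear hb',
    comp, eval₂_map] at h1
  rw [h1, map_mul, map_pow]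

variable {g : F[X]} {β : F}

theorem planeCurve_eq (g : F[X]) (β : F) : planeCurve g β =
    g.eval₂ (C.comp C) (C (C 1) * X + C 0) + g.eval₂ (C.comp C) (C (C β) * X + C X) +
      g.eval₂ (C.comp C) (C (C (1 + β)) * X + C X) + X * (C (C β) * X + C X) := by
  simp only [planeCurve, planarForm, map_add, map_one, map_zero, add_zero, one_mul]
  congr 3
  ring

theorem natDegree_planeCurve_le (hd : 3 ≤ g.natDegree) :
    (planeCurve g β).natDegree ≤ g.natDegree := by
  rw [planeCurve_eq]
  refine natDegree_add_le_of_degree_le (natDegree_add_le_of_degree_le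
    (natDegree_add_le_of_degree_le ?_ ?_) ?_) ?_
  · exact natDegree_eval₂_linear_le g 1 0
  · exact natDegree_eval₂_linear_le g β X
  · exact natDegree_eval₂_linear_le g (1 + β) X
  · refine natDegree_mul_le.trans ?_
    have := natDegree_linear_le (a := (C β : F[X])) (b := X)
    have := natDegree_X_le (R := F[X])
    omega

theorem coeff_planeCurve (hd : 3 ≤ g.natDegree) (hβ0 : β ≠ 0) (hβ1 : 1 + β ≠ 0) :
    (planeCurve g β).coeff g.natDegree =
      C (g.leadingCoeff * (1 + β ^ g.natDegree + (1 + β) ^ g.natDegree)) := by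
  rw [planeCurve_eq, coeff_add, coeff_add, coeff_add, coeff_eval₂_linear g one_ne_zero,
    coeff_eval₂_linear g hβ0, coeff_eval₂_linear g hβ1, coeff_eq_zero_of_natDegree_lt
      (p := X * (C (C β) * X + C X)), add_zero, ← map_add, ← map_add, one_pow]
  · congr 1; ring
  · refine lt_of_le_of_lt natDegree_mul_le ?_
    have := natDegree_linear_le (a := (C β : F[X])) (b := X)
    have := natDegree_X_le (R := F[X])
    omega

theorem natDegree_homog_planeCurve_le (hd : 3 ≤ g.natDegree) :
    (homog (planeCurve g β)).natDegree ≤ g.natDegree := by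
  have h1 : ∀ r : F[X][X],
      (g.eval₂ (homog.comp (C.comp C)) (C r * X)).natDegree ≤ g.natDegree := by
    intro r
    rw [eval₂_eq_sum_range]
    refine natDegree_sum_le_of_forall_le _ _ fun e he => ?_
    have : (homog.comp (C.comp C)) (g.coeff e) = C (C (C (g.coeff e))) := by simp [homog]
    rw [this]
    refine (natDegree_C_mul_le _ _).trans (natDegree_pow_le.trans ?_)
    have h2 := Finset.mem_range.mp he
    have h3 := natDegree_linear_le (a := r) (b := 0)
    rw [C_0, add_zero] at h3
    nlinarith
  have h2 : homog (X : F[X][X]) = C X * X := by simp [homog]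
  have h3 : homog (C (C β) * X + C X : F[X][X]) = C (C (C β) * X + C X) * X := by
    simp [homog]; ring
  have h6 : homog (planeCurve g β) = planarForm (homog.comp (C.comp C)) g (homog X)
      (homog (C (C β) * X + C X)) := by
    simp only [planeCurve, planarForm, map_add, map_mul, hom_eval₂]
  rw [h6, planarForm, h2, h3, ← add_mul, ← C_add]
  refine natDegree_add_le_of_degree_le (natDegree_add_le_of_degree_le
    (natDegree_add_le_of_degree_le (h1 _) (h1 _)) (h1 _)) ?_
  refine natDegree_mul_le.trans ?_
  have h4 := natDegree_linear_le (a := (X : F[X][X])) (b := 0)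
  have h5 := natDegree_linear_le (a := (C (C β) * X + C X : F[X][X])) (b := 0)
  rw [C_0, add_zero] at h4 h5
  omega

theorem natDegree_eval_le {P : F[X][X]}
    (htd : ∀ i j : ℕ, P.natDegree < i + j → (P.coeff j).coeff i = 0) {r : F[X]}
    (hr : r.natDegree ≤ 1) : (P.eval r).natDegree ≤ P.natDegree := by
  rw [eval_eq_sum_range]
  refine natDegree_sum_le_of_forall_le _ _ fun e he => ?_
  have h2 := Finset.mem_range.mp he
  have h1 : (P.coeff e).natDegree ≤ P.natDegree - e := by
    rw [natDegree_le_iff_coeff_eq_zero]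
    intro i hi
    exact htd i e (by omega)
  have h3 : (r ^ e).natDegree ≤ e := natDegree_pow_le.trans (by nlinarith)
  exact natDegree_mul_le.trans (by omega)

theorem eq_of_irreducible_of_eval_eq_zero {k E : Type*} [Field k] [CommRing E] [IsDomain E]
    {τ : k[X] →+* E} {P : k[X][X]} (hP : Irreducible P) {x : E} (hx : P.eval₂ τ x = 0)
    {r : k[X]} (hr : P.eval r = 0) : x = τ r := by
  have h1 : X - C r ∣ P := dvd_iff_isRoot.mpr hr
  have h2 : P ∣ X - C r := (irreducible_X_sub_C r).dvd_symm hP h1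
  obtain ⟨Q, hQ⟩ := h2
  have h3 := congrArg (eval₂ τ x) hQ
  rw [eval₂_mul, hx, zero_mul, eval₂_sub, eval₂_X, eval₂_C, sub_eq_zero] at h3
  exact h3

end Curve

theorem eval₂_planeCurve {F E : Type*} [Field F] [CommRing E] (i : F →+* E) (g : F[X]) (β : F)
    (t x : E) : (planeCurve g β).eval₂ (eval₂RingHom i t) x = planarForm i g x (i β * x + t) := by
  have h1 : ∀ r : F[X][X], (g.eval₂ (C.comp C) r).eval₂ (eval₂RingHom i t) x =
      g.eval₂ i (r.eval₂ (eval₂RingHom i t) x) := by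
    intro r
    rw [← coe_eval₂RingHom, hom_eval₂]
    congr 1
    ext c
    simp
  simp only [planeCurve, planarForm, eval₂_add, eval₂_mul, h1, eval₂_X, eval₂_C,
    coe_eval₂RingHom]

/-- A branch of the curve defined by the planar form, defined over the ground field and not
consisting of a single point, forces a rational point with nonzero coordinates. -/
theorem exists_planarForm_eq_zero {F : Type*} [Field F] [Fintype F] {m : ℕ}
    (hcard : Fintype.card F = 2 ^ m) {g : F[X]} (hd : 3 ≤ g.natDegree)
    (hdq : g.natDegree ^ 4 ≤ Fintype.card F) {β : F} (hβ0 : β ≠ 0) (hβ1 : 1 + β ≠ 0)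
    (hβ : 1 + β ^ g.natDegree + (1 + β) ^ g.natDegree ≠ 0)
    {k E : Type*} [Field k] [IsAlgClosed k] [CommRing E] [IsDomain E] {i : F →+* k} {s : k →+* k}
    (hs : ∀ x, s x = x → x ∈ i.range) (hsi : ∀ c, s (i c) = i c) {j : k →+* E} {σ : E →+* E}
    (hσ : ∀ x, σ (j x) = j (s x)) {x y : E} (hσx : σ x = x) (hσy : σ y = y) (hx0 : x ≠ 0)
    (hy0 : y ≠ 0) (hxy : planarForm (j.comp i) g x y = 0) (hnc : ∀ a b, x = j a → y = j b → False) :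
    ∃ x₀ y₀ : F, x₀ ≠ 0 ∧ y₀ ≠ 0 ∧ planarForm (RingHom.id F) g x₀ y₀ = 0 := by
  set t : E := y - j (i β) * x with ht
  set a : F := g.leadingCoeff * (1 + β ^ g.natDegree + (1 + β) ^ g.natDegree) with ha
  have hg0 : g.leadingCoeff ≠ 0 := by
    rw [Ne, leadingCoeff_eq_zero]
    rintro rfl
    simp at hd
  have ha0 : a ≠ 0 := mul_ne_zero hg0 hβ
  have hcoeff : (planeCurve g β).coeff g.natDegree = C a := coeff_planeCurve hd hβ0 hβ1
  have hnat : (planeCurve g β).natDegree = g.natDegree := by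
    refine le_antisymm (natDegree_planeCurve_le hd) (le_natDegree_of_ne_zero ?_)
    rw [hcoeff]
    exact C_ne_zero.mpr ha0
  have hlc : (planeCurve g β).leadingCoeff = C a := by rw [leadingCoeff, hnat, hcoeff]
  have hQ : (C (C a⁻¹) * planeCurve g β).Monic := by
    apply monic_C_mul_of_mul_leadingCoeff_eq_one
    rw [hlc, ← C_mul, inv_mul_cancel₀ ha0, C_1]
  have hQx : (planeCurve g β).eval₂ (eval₂RingHom (j.comp i) t) x = 0 := by
    rw [eval₂_planeCurve, ← hxy, ht]
    simp
  have hcomp : (eval₂RingHom j t).comp (mapRingHom i) = eval₂RingHom (j.comp i) t := by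
    ext <;> simp
  have hτ : Function.Injective (eval₂RingHom j t) := by
    rw [injective_iff_map_eq_zero]
    intro r hr
    by_contra hr0
    obtain ⟨t₀, ht₀⟩ := exists_eq_of_eval₂_eq_zero j hr0 hr
    have h1 : ((C (C a⁻¹) * planeCurve g β).map
        ((evalRingHom t₀).comp (mapRingHom i))).eval₂ j x = 0 := by
      rw [eval₂_map, eval₂_mul]
      have : j.comp ((evalRingHom t₀).comp (mapRingHom i)) = eval₂RingHom (j.comp i) t := by
        ext <;> simp [ht₀]
      rw [this, hQx, mul_zero]
    obtain ⟨x₀, hx₀⟩ := exists_eq_of_eval₂_eq_zero j (hQ.map _).ne_zero h1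
    refine hnc x₀ (t₀ + i β * x₀) hx₀ ?_
    rw [map_add, map_mul, ← ht₀, ← hx₀, ht]
    ring
  obtain ⟨P, hP, hirr, hPx, hmin⟩ := exists_irreducible_of_integral hτ (x := x)
    (hQ.map (mapRingHom i)) (by rw [eval₂_map, hcomp, eval₂_mul, hQx, mul_zero])
  obtain ⟨P₀, hP₀, rfl⟩ := exists_map_eq_of_stable hs hσ (t := t)
    (by rw [ht, map_sub, map_mul, hσ, hsi, hσx, hσy]) hσx hP hPx hmin
  obtain ⟨Q, hPQ⟩ : P₀ ∣ planeCurve g β := by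
    rw [← map_dvd_map (mapRingHom i) (map_injective i i.injective) hP₀]
    exact hmin _ (by rw [eval₂_map, hcomp, hQx])
  have htd := coeff_eq_zero_of_mul hP₀ ha0 (hPQ ▸ hnat) (hPQ ▸ hlc)
    (hPQ ▸ natDegree_homog_planeCurve_le hd)
  have hroot : ∀ r : F[X], P₀.eval r = 0 → x = eval₂RingHom j t (mapRingHom i r) := by
    intro r hr
    refine eq_of_irreducible_of_eval_eq_zero hirr hPx ?_
    rw [eval_map_apply, hr, map_zero]
  have hu₁ : P₀.eval 0 ≠ 0 := fun h => hx0 (by simpa using hroot 0 h)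
  have hu₂ : P₀.eval (C (-β⁻¹) * X) ≠ 0 := by
    intro h
    have h1 := hroot _ h
    apply hy0
    have h2 : j (i β) * j (i β⁻¹) = 1 := by
      rw [← map_mul, ← map_mul, mul_inv_cancel₀ hβ0, map_one, map_one]
    have h3 : x = - (j (i β⁻¹) * t) := by simpa using h1
    have h4 : y = t + j (i β) * x := by rw [ht]; ring
    rw [h4, h3]
    linear_combination (-t) * h2
  have hn : P₀.natDegree ≤ g.natDegree := by
    rw [← hnat]
    refine natDegree_le_of_dvd ⟨Q, hPQ⟩ ?_
    intro h
    rw [h, natDegree_zero] at hnat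
    omega
  obtain ⟨t₀, y₀, h1, h2⟩ := exists_point hcard i hP₀ htd hirr hd hn hdq (mul_ne_zero hu₁ hu₂) (by
    refine natDegree_mul_le.trans ?_
    have h1 := natDegree_eval_le htd (r := 0) (by simp)
    have h2 := natDegree_eval_le htd (r := C (-β⁻¹) * X) (by
      simpa using natDegree_linear_le (a := -β⁻¹) (b := 0))
    omega)
  have h3 : ∀ r : F[X], (P₀.eval r).eval t₀ = P₀.evalEval t₀ (r.eval t₀) := by
    intro r
    rw [← map_evalRingHom_eval, ← coe_evalRingHom, eval_map_apply]
  rw [eval_mul, mul_ne_zero_iff, h3, h3] at h1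
  refine ⟨y₀, β * y₀ + t₀, ?_, ?_, ?_⟩
  · rintro rfl
    exact h1.1 (by simpa using h2)
  · intro h
    apply h1.2
    have : (C (-β⁻¹) * X).eval t₀ = y₀ := by
      rw [eval_mul, eval_C, eval_X, eq_neg_of_add_eq_zero_right h]
      field_simp
    rw [this, h2]
  · have h4 : (planeCurve g β).evalEval t₀ y₀ = 0 := by
      rw [hPQ, evalEval_mul, h2, zero_mul]
    have h5 := eval₂_planeCurve (RingHom.id F) g β t₀ y₀
    rw [eval₂_eval₂RingHom_apply, mapRingHom_id, Polynomial.map_id, h4] at h5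
    exact h5.symm

theorem charP_two_of_card {F : Type*} [Field F] [Fintype F] {m : ℕ}
    (hcard : Fintype.card F = 2 ^ m) : CharP F 2 := by
  have : Fact (Nat.Prime 2) := ⟨Nat.prime_two⟩
  exact charP_of_card_eq_prime_pow (f := m) (by rw [← hcard])

theorem mem_range_of_frobenius_eq {F k : Type*} [Field F] [Fintype F] [Field k] [Algebra F k] {x : k}
    (hx : FiniteField.frobeniusAlgHom F k x = x) : x ∈ (algebraMap F k).range := by
  have h1 := congrArg (eval₂ (algebraMap F k) x) (prod_X_sub_C_univ F)
  have h2 : x ^ Fintype.card F = x := hx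
  rw [← coe_eval₂RingHom, map_prod] at h1
  simp only [coe_eval₂RingHom, eval₂_sub, eval₂_X, eval₂_C, eval₂_X_pow, h2, sub_self,
    Finset.prod_eq_zero_iff, Finset.mem_univ, true_and] at h1
  obtain ⟨a, ha⟩ := h1
  exact ⟨a, (sub_eq_zero.mp ha).symm⟩

/-- For an exponent that is not a power of two, `1 + β ^ d + (1 + β) ^ d` is not identically
zero on a field with more than `d` elements. -/
theorem exists_one_add_pow_ne_zero {F : Type*} [Field F] [Fintype F] [CharP F 2] {d : ℕ} (hd : 3 ≤ d)
    (hdF : d < Fintype.card F) (hd2 : ∀ r : ℕ, d ≠ 2 ^ r) :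
    ∃ β : F, β ≠ 0 ∧ 1 + β ≠ 0 ∧ 1 + β ^ d + (1 + β) ^ d ≠ 0 := by
  have h2 : (2 : F) = 0 := CharTwo.two_eq_zero
  by_contra! H
  have hroot : ∀ β : F, 1 + β ^ d + (1 + β) ^ d = 0 := by
    intro β
    by_cases h0 : β = 0
    · subst h0
      rw [zero_pow (by omega), add_zero, one_pow]
      linear_combination h2
    by_cases h1 : 1 + β = 0
    · have : β = 1 := by linear_combination h1 - h2
      rw [h1, this, one_pow, zero_pow (by omega), add_zero]
      linear_combination h2
    exact H β h0 h1
  have hp : (1 + X ^ d + (1 + X) ^ d : F[X]) = 0 := by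
    refine eq_zero_of_natDegree_lt_card_of_eval_eq_zero' _ Finset.univ (fun β _ => ?_) ?_
    · simpa using hroot β
    · rw [Finset.card_univ]
      refine lt_of_le_of_lt ?_ hdF
      refine natDegree_add_le_of_degree_le (natDegree_add_le_of_degree_le (by simp) (by simp)) ?_
      refine natDegree_pow_le.trans ?_
      have : (1 + X : F[X]).natDegree ≤ 1 := by
        rw [add_comm]
        exact (natDegree_X_add_C (1 : F)).le
      nlinarith
  have hch : ∀ j : ℕ, 0 < j → j < d → ((d.choose j : ℕ) : F) = 0 := by
    intro j hj hjd
    have := congrArg (fun p => p.coeff j) hp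
    simpa [coeff_one_add_X_pow, coeff_one, coeff_X_pow, hj.ne', hjd.ne] using this
  obtain ⟨v, o, ho, hdo⟩ := Nat.exists_eq_two_pow_mul_odd (n := d) (by omega)
  have ho1 : 1 < o := by
    obtain ⟨e, rfl⟩ := ho
    rcases Nat.eq_zero_or_pos e with rfl | he
    · exact absurd (by simpa using hdo) (hd2 v)
    · omega
  have hv : 0 < 2 ^ v := by positivity
  have h4 := hch (2 ^ v) hv (by rw [hdo]; nlinarith)
  have h5 : (1 + X : F[X]) ^ d = expand F (2 ^ v) ((1 + X) ^ o) := by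
    rw [hdo, pow_mul, add_pow_char_pow, one_pow]
    simp
  have h6 := congrArg (fun p => p.coeff (2 ^ v * 1)) h5
  beta_reduce at h6
  rw [coeff_expand_mul' hv, mul_one, coeff_one_add_X_pow, coeff_one_add_X_pow, h4,
    Nat.choose_one_right] at h6
  obtain ⟨e, rfl⟩ := ho
  apply one_ne_zero (α := F)
  push_cast at h6
  linear_combination -h6 - (e : F) * h2

/-- A Galois invariant branch of the curve defined by the planar form, given by homogeneous
coordinates `(x : y : z ^ r)`, forces a rational point with nonzero coordinates. -/
theorem exists_planarForm_eq_zero_of_branch {F : Type*} [Field F] [Fintype F] {m : ℕ}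
    (hcard : Fintype.card F = 2 ^ m) {g : F[X]} (hd : 3 ≤ g.natDegree)
    (hdq : g.natDegree ^ 4 ≤ Fintype.card F) (hg : ∀ n ∈ g.support, 2 ≤ n ∧ ∀ r : ℕ, n ≠ 2 ^ r)
    {D : Type*} [CommRing D] [IsDomain D] {j : AlgebraicClosure F →+* D} {σ : D →+* D}
    (hσ : Function.Injective σ)
    (hj : ∀ x, σ (j x) = j (FiniteField.frobeniusAlgHom F (AlgebraicClosure F) x))
    {x y z : D} (hσx : σ x = x) (hσy : σ y = y) (hσz : σ z = z) (hx0 : x ≠ 0) (hy0 : y ≠ 0)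
    (hz0 : z ≠ 0) (r : ℕ) (T : ℕ → D)
    (hT : ∀ n ∈ g.support, z ^ (r * (n - 2)) * T n = x ^ n + y ^ n + (x + y) ^ n)
    (hsum : ∑ n ∈ g.support, j (algebraMap F _ (g.coeff n)) * T n + x * y = 0)
    (hnc : ∀ a b, x = j a * z ^ r → y = j b * z ^ r → False) :
    ∃ x₀ y₀ : F, x₀ ≠ 0 ∧ y₀ ≠ 0 ∧ planarForm (RingHom.id F) g x₀ y₀ = 0 := by
  have := charP_two_of_card hcard
  have hg0 : g ≠ 0 := by
    rintro rfl
    simp at hd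
  obtain ⟨β, hβ0, hβ1, hβ⟩ := exists_one_add_pow_ne_zero (F := F) hd
    (lt_of_lt_of_le (lt_self_pow₀ (by omega) (by omega)) hdq) (hg _ (natDegree_mem_support_of_nonzero hg0)).2
  let E := FractionRing D
  let w : E := algebraMap D E z
  have hinj : Function.Injective (algebraMap D E) := IsFractionRing.injective D E
  have hw : w ≠ 0 := by
    rw [Ne, map_eq_zero_iff _ hinj]
    exact hz0
  have hmap : ∀ a : D, IsFractionRing.map (K := E) (L := E) hσ (algebraMap D E a) =
      algebraMap D E (σ a) := fun a => IsLocalization.map_eq _ _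
  have hfix : ∀ a : D, σ a = a → IsFractionRing.map (K := E) (L := E) hσ
      (algebraMap D E a / w ^ r) = algebraMap D E a / w ^ r := by
    intro a ha
    rw [map_div₀, map_pow, hmap, hmap, ha, hσz]
  refine exists_planarForm_eq_zero hcard hd hdq hβ0 hβ1 hβ (i := algebraMap F (AlgebraicClosure F))
    (s := (FiniteField.frobeniusAlgHom F (AlgebraicClosure F) : _ →+* _))
    (fun x hx => mem_range_of_frobenius_eq hx) (fun c => ?_)
    (j := (algebraMap D E).comp j) (σ := IsFractionRing.map hσ) (fun x => ?_)
    (hfix x hσx) (hfix y hσy)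
    (div_ne_zero ((map_ne_zero_iff _ hinj).mpr hx0) (pow_ne_zero _ hw))
    (div_ne_zero ((map_ne_zero_iff _ hinj).mpr hy0) (pow_ne_zero _ hw)) ?_ ?_
  · exact AlgHom.commutes (FiniteField.frobeniusAlgHom F (AlgebraicClosure F)) c
  · rw [RingHom.comp_apply, hmap, hj]
    rfl
  · have h1 := congrArg (algebraMap D E) hsum
    rw [map_add, map_sum, map_mul, map_zero] at h1
    rw [planarForm, eval₂_eq_sum, eval₂_eq_sum, eval₂_eq_sum, Polynomial.sum, Polynomial.sum,
      Polynomial.sum, ← Finset.sum_add_distrib, ← Finset.sum_add_distrib]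
    have h2 : w ^ (2 * r) ≠ 0 := pow_ne_zero _ hw
    apply mul_left_cancel₀ h2
    rw [mul_zero, ← h1, mul_add, Finset.mul_sum]
    congr 1
    · refine Finset.sum_congr rfl fun n hn => ?_
      have h3 := congrArg (algebraMap D E) (hT n hn)
      simp only [map_add, map_mul, map_pow] at h3 ⊢
      have h4 : (w ^ r) ^ n = w ^ (2 * r) * w ^ (r * (n - 2)) := by
        rw [← pow_mul, ← pow_add, mul_comm 2, ← mul_add, Nat.add_sub_cancel' (hg n hn).1]
      have h5 : w ^ (r * (n - 2)) ≠ 0 := pow_ne_zero _ hw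
      rw [← add_div, div_pow, div_pow, div_pow, h4, ← mul_add, ← mul_add, ← add_div, ← add_div,
        ← h3]
      rw [mul_comm (w ^ (2 * r)) (w ^ (r * (n - 2))), mul_div_mul_left _ _ h5, mul_left_comm,
        mul_div_cancel₀ _ h2]
      rfl
    · rw [div_mul_div_comm, ← pow_add, ← two_mul, mul_div_cancel₀ _ h2]
  · intro a b ha hb
    refine hnc a b ?_ ?_
    · apply hinj
      rw [div_eq_iff (pow_ne_zero _ hw)] at ha
      rw [map_mul, map_pow, ha]
      rfl
    · apply hinj
      rw [div_eq_iff (pow_ne_zero _ hw)] at hb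
      rw [map_mul, map_pow, hb]
      rfl

theorem two_pow_mul_div {n : ℕ} (hn : n ≠ 0) :
    2 ^ padicValNat 2 n * (n / 2 ^ padicValNat 2 n) = n ∧ Odd (n / 2 ^ padicValNat 2 n) := by
  have h1 := Nat.mul_div_cancel' (pow_padicValNat_dvd (p := 2) (n := n))
  refine ⟨h1, ?_⟩
  rw [← Nat.not_even_iff_odd]
  rintro ⟨e, he⟩
  apply pow_succ_padicValNat_not_dvd (p := 2) hn
  refine ⟨e, ?_⟩
  conv_lhs => rw [← h1, he]
  ring

theorem le_of_choose_ne_zero {F : Type*} [Field F] [CharP F 2] {n j : ℕ} (hj : 0 < j)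
    (h : ((n.choose j : ℕ) : F) ≠ 0) : 2 ^ padicValNat 2 n ≤ j := by
  have hodd : Odd (n.choose j) := by
    rw [← Nat.not_even_iff_odd]
    intro he
    exact h ((CharP.cast_eq_zero_iff F 2 _).mpr he.two_dvd)
  apply Nat.le_of_dvd hj
  obtain ⟨i, rfl⟩ : ∃ i, j = i + 1 := ⟨j - 1, by omega⟩
  cases n with
  | zero => simp at hodd
  | succ n =>
    have h1 := Nat.add_one_mul_choose_eq n i
    refine ((Nat.coprime_two_left.mpr hodd).pow_left _).dvd_of_dvd_mul_left ?_
    rw [← h1]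
    exact (pow_padicValNat_dvd).mul_right _

/-- The normalized exponents `(n - 2) / 2 ^ v(n)` are pairwise distinct. -/
theorem eq_of_mul_two_pow_eq {n l : ℕ} (hn2 : 2 ≤ n) (hl2 : 2 ≤ l)
    (h : (n - 2) * 2 ^ padicValNat 2 l = (l - 2) * 2 ^ padicValNat 2 n) : n = l := by
  have key : ∀ n l : ℕ, 2 ≤ n → 2 ≤ l →
      (n - 2) * 2 ^ padicValNat 2 l = (l - 2) * 2 ^ padicValNat 2 n →
      ¬ padicValNat 2 l < padicValNat 2 n := by
    intro n l hn2 hl2 h hlt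
    obtain ⟨hn1, u, hu⟩ := two_pow_mul_div (show n ≠ 0 by omega)
    obtain ⟨hl1, w, hw⟩ := two_pow_mul_div (show l ≠ 0 by omega)
    rw [hu] at hn1
    rw [hw] at hl1
    generalize padicValNat 2 n = a at *
    generalize padicValNat 2 l = b at *
    obtain ⟨c, rfl⟩ := Nat.exists_eq_add_of_lt hlt
    zify [hn2, hl2] at h
    have hn3 : (n : ℤ) = 2 ^ (b + c + 1) * (2 * u + 1) := by exact_mod_cast hn1.symm
    have hl3 : (l : ℤ) = 2 ^ b * (2 * w + 1) := by exact_mod_cast hl1.symm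
    rw [hn3, hl3] at h
    have hb : (2 : ℤ) ^ (b + 1) ≠ 0 := by positivity
    have h2 : (2 : ℤ) ^ (b + c) * (2 * u + 1) - 1 = 2 ^ (b + c) * (2 * w + 1) - 2 ^ (c + 1) := by
      apply mul_left_cancel₀ hb
      linear_combination h
    rcases Nat.eq_zero_or_pos (b + c) with h0 | h0
    · have hb0 : b = 0 := by omega
      have hc0 : c = 0 := by omega
      subst hb0 hc0
      norm_num at h2
      omega
    · obtain ⟨e, he⟩ := Nat.exists_eq_add_of_le' h0
      rw [he] at h2
      have h3 : (2 : ℤ) * (2 ^ e * (2 * u + 1) - 2 ^ e * (2 * w + 1) + 2 ^ c) = 1 := by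
        linear_combination h2
      omega
  have h1 := key n l hn2 hl2 h
  have h2 := key l n hl2 hn2 h.symm
  have h3 : padicValNat 2 n = padicValNat 2 l := by omega
  rw [h3] at h
  have := Nat.eq_of_mul_eq_mul_right (by positivity) h
  omega

theorem exists_dominant_exponent {s : Finset ℕ} (hs : s.Nonempty)
    (h : ∀ n ∈ s, 2 ≤ n) :
    ∃ l ∈ s, ∀ n ∈ s, n ≠ l →
      (n - 2) * 2 ^ padicValNat 2 l < (l - 2) * 2 ^ padicValNat 2 n := by
  obtain ⟨l, hl, hmax⟩ := s.exists_max_image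
    (fun n => ((n - 2 : ℕ) : ℚ) / 2 ^ padicValNat 2 n) hs
  refine ⟨l, hl, fun n hn hnl => ?_⟩
  have h1 := hmax n hn
  rw [div_le_div_iff₀ (by positivity) (by positivity)] at h1
  refine lt_of_le_of_ne (by exact_mod_cast h1) fun h2 => hnl ?_
  exact eq_of_mul_two_pow_eq (h n hn) (h l hl) h2

section PowerSeriesBranch

variable {F : Type*} [Field F] [Fintype F] {m : ℕ}

theorem exists_planarForm_eq_zero_of_powerSeries (hcard : Fintype.card F = 2 ^ m) {g : F[X]}
    (hd : 3 ≤ g.natDegree) (hdq : g.natDegree ^ 4 ≤ Fintype.card F)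
    (hg : ∀ n ∈ g.support, 2 ≤ n ∧ ∀ r : ℕ, n ≠ 2 ^ r) {y : PowerSeries F} (hy0 : y ≠ 0)
    (T : ℕ → PowerSeries F)
    (hT : ∀ n ∈ g.support, PowerSeries.X ^ (n - 2) * T n = 1 + y ^ n + (1 + y) ^ n)
    (hsum : ∑ n ∈ g.support, PowerSeries.C (g.coeff n) * T n + y = 0) :
    ∃ x₀ y₀ : F, x₀ ≠ 0 ∧ y₀ ≠ 0 ∧ planarForm (RingHom.id F) g x₀ y₀ = 0 := by
  let i := algebraMap F (AlgebraicClosure F)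
  let s : AlgebraicClosure F →+* AlgebraicClosure F :=
    FiniteField.frobeniusAlgHom F (AlgebraicClosure F)
  have hinj : ∀ {A B : Type _} [Field A] [Field B] (φ : A →+* B),
      Function.Injective (PowerSeries.map φ) := by
    intro A B _ _ φ a b hab
    ext n
    apply φ.injective
    simpa using congrArg (PowerSeries.coeff n) hab
  have hs : ∀ a, PowerSeries.map s (PowerSeries.map i a) = PowerSeries.map i a := by
    intro a
    ext n
    simp only [PowerSeries.coeff_map]
    exact AlgHom.commutes (FiniteField.frobeniusAlgHom F (AlgebraicClosure F)) _
  refine exists_planarForm_eq_zero_of_branch hcard hd hdq hg (D := PowerSeries (AlgebraicClosure F))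
    (j := PowerSeries.C) (σ := PowerSeries.map s) (hinj s) (fun x => PowerSeries.map_C _ _)
    (x := 1) (y := PowerSeries.map i y) (z := PowerSeries.X) (map_one _) (hs y)
    (PowerSeries.map_X _) one_ne_zero ?_ PowerSeries.X_ne_zero 1 (fun n => PowerSeries.map i (T n))
    (fun n hn => ?_) ?_ ?_
  · rw [Ne, map_eq_zero_iff _ (hinj i)]
    exact hy0
  · have := congrArg (PowerSeries.map i) (hT n hn)
    simpa using this
  · have := congrArg (PowerSeries.map i) hsum
    simpa using this
  · intro a b h _
    have := congrArg PowerSeries.constantCoeff h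
    simp at this

variable [CharP F 2]

theorem one_add_pow_add {A : Type*} [CommRing A] [CharP A 2] {n : ℕ} (hn : n ≠ 0) (u : A) :
    1 + u ^ n + (1 + u) ^ n = ∑ j ∈ Finset.Ico 1 n, (n.choose j : A) * u ^ j := by
  have h2 : (2 : A) = 0 := CharTwo.two_eq_zero
  rw [add_comm 1 u, add_pow, Finset.sum_range_succ, Finset.range_eq_Ico,
    Finset.sum_eq_sum_Ico_succ_bot (by omega)]
  simp only [one_pow, mul_one, pow_zero, Nat.choose_zero_right, Nat.choose_self, Nat.cast_one,
    zero_add]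
  rw [Finset.sum_congr rfl fun j _ => mul_comm (u ^ j) _]
  linear_combination (1 + u ^ n) * h2

end PowerSeriesBranch

section

variable {F : Type*} [Field F] [CharP F 2]

instance charP_powerSeries {k : Type*} [Field k] [CharP k 2] : CharP (PowerSeries k) 2 :=
  charP_of_injective_ringHom (f := PowerSeries.C (R := k)) PowerSeries.C_injective 2

theorem pow_mul_sum_choose {n p : ℕ} (hn : n ≠ 0)
    (h : ∀ j, 1 ≤ j → ((n.choose j : ℕ) : F) ≠ 0 → n - 2 ≤ j * p) (y : PowerSeries F) :
    (PowerSeries.X : PowerSeries F) ^ (n - 2) * ∑ j ∈ Finset.Ico 1 n,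
        PowerSeries.C (n.choose j : F) * PowerSeries.X ^ (j * p - (n - 2)) * y ^ j =
      1 + (PowerSeries.X ^ p * y) ^ n + (1 + PowerSeries.X ^ p * y) ^ n := by
  rw [one_add_pow_add hn, Finset.mul_sum]
  refine Finset.sum_congr rfl fun j hj => ?_
  by_cases h0 : ((n.choose j : ℕ) : F) = 0
  · have : ((n.choose j : ℕ) : PowerSeries F) = 0 := by
      rw [← map_natCast (PowerSeries.C (R := F)), h0, map_zero]
    rw [h0, this]
    simp
  · have h1 := h j (Finset.mem_Ico.mp hj).1 h0
    have h2 : (PowerSeries.X : PowerSeries F) ^ (j * p) =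
      PowerSeries.X ^ (n - 2) * PowerSeries.X ^ (j * p - (n - 2)) := by
      rw [← pow_add, Nat.add_sub_cancel' h1]
    rw [mul_pow, ← pow_mul, mul_comm p j, h2, map_natCast]
    ring

theorem exists_planarForm_eq_zero_of_odd [Fintype F] {m : ℕ} (hcard : Fintype.card F = 2 ^ m) {g : F[X]}
    (hd : 3 ≤ g.natDegree) (hdq : g.natDegree ^ 4 ≤ Fintype.card F)
    (hg : ∀ n ∈ g.support, 2 ≤ n ∧ ∀ r : ℕ, n ≠ 2 ^ r) {l : ℕ} (hl : l ∈ g.support)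
    (hmax : ∀ n ∈ g.support, n ≠ l →
      (n - 2) * 2 ^ padicValNat 2 l < (l - 2) * 2 ^ padicValNat 2 n)
    (hodd : padicValNat 2 l = 0) :
    ∃ x₀ y₀ : F, x₀ ≠ 0 ∧ y₀ ≠ 0 ∧ planarForm (RingHom.id F) g x₀ y₀ = 0 := by
  have hlo : Odd l := by
    have := (two_pow_mul_div (show l ≠ 0 by have := (hg l hl).1; omega)).2
    rwa [hodd, pow_zero, Nat.div_one] at this
  have hl3 : 3 ≤ l := by
    have h1 := (hg l hl).1
    have h2 := (hg l hl).2 1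
    omega
  have hlt : ∀ n ∈ g.support, ∀ j, 1 ≤ j → ((n.choose j : ℕ) : F) ≠ 0 → ¬ (n = l ∧ j = 1) →
      n - 2 < j * (l - 2) := by
    intro n hn j hj h0 hne
    have h1 := le_of_choose_ne_zero hj h0
    by_cases hnl : n = l
    · have : 2 ≤ j := by
        by_contra h
        exact hne ⟨hnl, by omega⟩
      rw [hnl]
      nlinarith [show 0 < l - 2 by omega]
    · have h2 := hmax n hn hnl
      rw [hodd, pow_zero, mul_one, mul_comm] at h2
      exact lt_of_lt_of_le h2 (Nat.mul_le_mul_right _ h1)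
  have ha : g.coeff l ≠ 0 := mem_support_iff.mp hl
  let G : (PowerSeries F)[X] := ∑ n ∈ g.support, C (PowerSeries.C (g.coeff n)) *
    ∑ j ∈ Finset.Ico 1 n, C (PowerSeries.C (n.choose j : F) *
      PowerSeries.X ^ (j * (l - 2) - (n - 2))) * X ^ j + (1 + C (PowerSeries.X ^ (l - 2)) * X)
  have hGm : G.map PowerSeries.constantCoeff = C (g.coeff l) * X + 1 := by
    simp only [G, Polynomial.map_add, Polynomial.map_sum, Polynomial.map_mul, Polynomial.map_C,
      Polynomial.map_pow, Polynomial.map_X, Polynomial.map_one, map_mul, map_pow,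
      PowerSeries.constantCoeff_C, PowerSeries.constantCoeff_X, C_0]
    rw [zero_pow (show l - 2 ≠ 0 by omega), zero_mul, add_zero]
    congr 1
    have hz : ∀ n ∈ g.support, ∀ j ∈ Finset.Ico 1 n, ¬ (n = l ∧ j = 1) →
        C (n.choose j : F) * (0 : F[X]) ^ (j * (l - 2) - (n - 2)) * X ^ j = 0 := by
      intro n hn j hj hne
      by_cases h0 : ((n.choose j : ℕ) : F) = 0
      · simp [h0]
      · have := hlt n hn j (Finset.mem_Ico.mp hj).1 h0 hne
        rw [zero_pow (by omega), mul_zero, zero_mul]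
    rw [Finset.sum_eq_single_of_mem l hl, Finset.sum_eq_single_of_mem 1]
    · rw [Nat.choose_one_right, one_mul, Nat.sub_self, pow_zero, mul_one, pow_one]
      obtain ⟨e, rfl⟩ := hlo
      push_cast
      simp [CharTwo.two_eq_zero]
    · rw [Finset.mem_Ico]
      omega
    · intro j hj hj1
      exact hz l hl j hj (fun h => hj1 h.2)
    · intro n hn hnl
      rw [Finset.sum_eq_zero, mul_zero]
      intro j hj
      exact hz n hn j hj (fun h => hnl h.1)
  obtain ⟨y, hy, hy0⟩ := exists_powerSeries_root G (-(g.coeff l)⁻¹) (by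
    rw [hGm]
    simp [ha]) (by
    rw [hGm]
    simpa using ha)
  have hne : (1 + PowerSeries.X ^ (l - 2) * y : PowerSeries F) ≠ 0 := by
    intro h
    have := congrArg PowerSeries.constantCoeff h
    simp [show l - 2 ≠ 0 by omega] at this
  refine exists_planarForm_eq_zero_of_powerSeries hcard hd hdq hg hne
    (fun n => ∑ j ∈ Finset.Ico 1 n,
        PowerSeries.C (n.choose j : F) * PowerSeries.X ^ (j * (l - 2) - (n - 2)) * y ^ j)
    (fun n hn => ?_) ?_
  · have h2 : (2 : PowerSeries F) = 0 := CharTwo.two_eq_zero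
    rw [pow_mul_sum_choose (by have := (hg n hn).1; omega)]
    · rw [← add_assoc, one_add_one_eq_two, h2, zero_add]
      ring
    · intro j hj h0
      by_cases hne : n = l ∧ j = 1
      · rw [hne.1, hne.2, one_mul]
      · exact (hlt n hn j hj h0 hne).le
  · rw [← hy]
    simp only [G, eval_add, eval_finsetSum, eval_mul, eval_C, eval_pow, eval_X, eval_one]

end

section

variable {F : Type*} [Field F] [CharP F 2]

theorem natCast_eq_one_of_odd {n : ℕ} (h : Odd n) : (n : F) = 1 := by
  obtain ⟨e, rfl⟩ := h
  push_cast
  simp [CharTwo.two_eq_zero]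

theorem natCast_eq_zero_of_even {n : ℕ} (h : Even n) : (n : F) = 0 :=
  (CharP.cast_eq_zero_iff F 2 _).mpr h.two_dvd

theorem exists_shift {g : F[X]} (hg : ∀ n ∈ g.support, 2 ≤ n ∧ ∀ r : ℕ, n ≠ 2 ^ r) {κ : ℕ}
    (hκ : 0 < κ) (hb : ∀ n ∈ g.support, Odd n → n - 2 < κ) :
    ∃ r, 1 ≤ r ∧ r ≤ κ ∧ (∀ n ∈ g.support, Odd n → n - 1 ≤ r) ∧
      ∑ n ∈ g.support, g.coeff n * ((n : F) * 0 ^ (r - (n - 1))) + 0 ^ (r - 1) ≠ 0 := by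
  by_cases hodd : ∃ n ∈ g.support, Odd n
  · have hne : (g.support.filter Odd).Nonempty := by
      obtain ⟨n, hn, hn'⟩ := hodd
      exact ⟨n, Finset.mem_filter.mpr ⟨hn, hn'⟩⟩
    obtain ⟨l, hl, hmax⟩ := (g.support.filter Odd).exists_max_image id hne
    obtain ⟨hl, hlo⟩ := Finset.mem_filter.mp hl
    have hmax' : ∀ n ∈ g.support, Odd n → n ≤ l := fun n hn hno =>
      hmax n (Finset.mem_filter.mpr ⟨hn, hno⟩)
    have h1 := (hg l hl).1
    have h2 := (hg l hl).2 1
    have h3 := hb l hl hlo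
    refine ⟨l - 1, by omega, by omega, fun n hn hno => ?_, ?_⟩
    · have := hmax' n hn hno
      omega
    · rw [zero_pow (show l - 1 - 1 ≠ 0 by omega), add_zero, Finset.sum_eq_single_of_mem l hl]
      · rw [natCast_eq_one_of_odd hlo, Nat.sub_self, pow_zero, mul_one, mul_one]
        exact mem_support_iff.mp hl
      · intro n hn hnl
        rcases Nat.even_or_odd n with he | ho
        · rw [natCast_eq_zero_of_even he]
          ring
        · have := hmax' n hn ho
          have := (hg n hn).1
          rw [zero_pow (by omega)]
          ring
  · push Not at hodd
    refine ⟨1, le_rfl, hκ, fun n hn hno => absurd hno (hodd n hn), ?_⟩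
    rw [Finset.sum_eq_zero]
    · simp
    · intro n hn
      rw [natCast_eq_zero_of_even (Nat.not_odd_iff_even.mp (hodd n hn))]
      ring

theorem exists_planarForm_eq_zero_of_two_mul_odd [Fintype F] {m : ℕ}
    (hcard : Fintype.card F = 2 ^ m) {g : F[X]}
    (hd : 3 ≤ g.natDegree) (hdq : g.natDegree ^ 4 ≤ Fintype.card F)
    (hg : ∀ n ∈ g.support, 2 ≤ n ∧ ∀ r : ℕ, n ≠ 2 ^ r) {l : ℕ} (hl : l ∈ g.support)
    (hmax : ∀ n ∈ g.support, n ≠ l →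
      (n - 2) * 2 ^ padicValNat 2 l < (l - 2) * 2 ^ padicValNat 2 n)
    (hval : padicValNat 2 l = 1) :
    ∃ x₀ y₀ : F, x₀ ≠ 0 ∧ y₀ ≠ 0 ∧ planarForm (RingHom.id F) g x₀ y₀ = 0 := by
  have hg3 : ∀ n ∈ g.support, 3 ≤ n := by
    intro n hn
    have h1 := (hg n hn).1
    have h2 := (hg n hn).2 1
    omega
  obtain ⟨κ, hκ, rfl⟩ : ∃ κ, 0 < κ ∧ l = 2 * κ + 2 := by
    have h1 := pow_padicValNat_dvd (p := 2) (n := l)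
    rw [hval, pow_one] at h1
    obtain ⟨o, rfl⟩ := h1
    have := hg3 _ hl
    exact ⟨o - 1, by omega, by omega⟩
  have hchoose : (((2 * κ + 2).choose 2 : ℕ) : F) = 1 := by
    apply natCast_eq_one_of_odd
    have h1 := (two_pow_mul_div (show 2 * κ + 2 ≠ 0 by omega)).2
    rw [hval, pow_one] at h1
    have h2 : (2 * κ + 2) / 2 = κ + 1 := by omega
    rw [h2] at h1
    rw [Nat.choose_two_right, show (2 * κ + 2) * (2 * κ + 2 - 1) = 2 * ((κ + 1) * (2 * κ + 1)) by
      rw [show 2 * κ + 2 - 1 = 2 * κ + 1 by omega]; ring, Nat.mul_div_cancel_left _ (by omega)]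
    exact h1.mul ⟨κ, rfl⟩
  have hmax' : ∀ n ∈ g.support, n ≠ 2 * κ + 2 → n - 2 < κ * 2 ^ padicValNat 2 n := by
    intro n hn hnl
    have := hmax n hn hnl
    rw [hval, pow_one, Nat.add_sub_cancel] at this
    nlinarith
  obtain ⟨r, hr1, hrκ, hr, hA⟩ := exists_shift hg hκ (by
    intro n hn hno
    have hv : padicValNat 2 n = 0 := padicValNat.eq_zero_of_not_dvd (by
      rwa [← even_iff_two_dvd, Nat.not_even_iff_odd])
    have h1 := hmax' n hn (by
      rintro rfl
      rw [hv] at hval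
      omega)
    rwa [hv, pow_zero, mul_one] at h1)
  obtain ⟨p, hp⟩ : ∃ p, p + r = 2 * κ + 1 := ⟨2 * κ + 1 - r, by omega⟩
  have hlt : ∀ n ∈ g.support, ∀ j, 2 ≤ j → ((n.choose j : ℕ) : F) ≠ 0 →
      ¬ (n = 2 * κ + 2 ∧ j = 2) → n - 1 < (j - 1) * p + r := by
    intro n hn j hj h0 hne
    have h1 := le_of_choose_ne_zero (by omega) h0
    have h3 := hg3 n hn
    obtain ⟨i, rfl⟩ := Nat.exists_eq_add_of_le' hj
    have h4 : (i + 2 - 1) * p + r = i * p + (2 * κ + 1) := by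
      rw [← hp, show i + 2 - 1 = i + 1 by omega]; ring
    have h5 : i * (κ + 1) ≤ i * p := Nat.mul_le_mul_left _ (by omega)
    rw [h4]
    by_cases hnl : n = 2 * κ + 2
    · have : 0 < i := by
        by_contra h
        exact hne ⟨hnl, by omega⟩
      nlinarith [show n - 1 = 2 * κ + 1 by omega]
    · have h6 := lt_of_lt_of_le (hmax' n hn hnl) (Nat.mul_le_mul_left _ h1)
      have h7 : n - 1 = n - 2 + 1 := by omega
      rw [h7]
      nlinarith
  have hle : ∀ n ∈ g.support, ∀ j, 1 ≤ j → ((n.choose j : ℕ) : F) ≠ 0 →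
      n - 1 ≤ (j - 1) * p + r := by
    intro n hn j hj h0
    rcases Nat.lt_or_ge 1 j with h1 | h1
    · by_cases hne : n = 2 * κ + 2 ∧ j = 2
      · rw [hne.1, hne.2]
        omega
      · exact (hlt n hn j h1 h0 hne).le
    · have hj1 : j = 1 := by omega
      subst hj1
      have := hr n hn (by
        rw [← Nat.not_even_iff_odd]
        intro he
        exact h0 (by rw [Nat.choose_one_right, natCast_eq_zero_of_even he]))
      omega
  have ha : g.coeff (2 * κ + 2) ≠ 0 := mem_support_iff.mp hl
  set a := ∑ n ∈ g.support, g.coeff n * ((n : F) * 0 ^ (r - (n - 1))) + 0 ^ (r - 1) with ha_def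
  let G : (PowerSeries F)[X] := ∑ n ∈ g.support, C (PowerSeries.C (g.coeff n)) *
    ∑ j ∈ Finset.Ico 1 n, C (PowerSeries.C (n.choose j : F) *
      PowerSeries.X ^ ((j - 1) * p + r - (n - 1))) * X ^ (j - 1) + C (PowerSeries.X ^ (r - 1))
  have hGm : G.map PowerSeries.constantCoeff = C (g.coeff (2 * κ + 2)) * X + C a := by
    have hz : ∀ n ∈ g.support, ∀ j ∈ Finset.Ico 2 n, ¬ (n = 2 * κ + 2 ∧ j = 2) →
        C (n.choose j : F) * (0 : F[X]) ^ ((j - 1) * p + r - (n - 1)) * X ^ (j - 1) = 0 := by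
      intro n hn j hj hne
      by_cases h0 : ((n.choose j : ℕ) : F) = 0
      · simp [h0]
      · have := hlt n hn j (Finset.mem_Ico.mp hj).1 h0 hne
        rw [zero_pow (by omega), mul_zero, zero_mul]
    have h1 : ∑ n ∈ g.support, C (g.coeff n) * ∑ j ∈ Finset.Ico 2 n,
        C (n.choose j : F) * (0 : F[X]) ^ ((j - 1) * p + r - (n - 1)) * X ^ (j - 1) =
        C (g.coeff (2 * κ + 2)) * X := by
      rw [Finset.sum_eq_single_of_mem _ hl, Finset.sum_eq_single_of_mem 2]
      · rw [hchoose, show (2 - 1) * p + r - (2 * κ + 2 - 1) = 0 by omega]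
        simp
      · rw [Finset.mem_Ico]
        omega
      · intro j hj hj1
        exact hz _ hl j hj (fun h => hj1 h.2)
      · intro n hn hnl
        rw [Finset.sum_eq_zero, mul_zero]
        intro j hj
        exact hz n hn j hj (fun h => hnl h.1)
    rw [← h1, ha_def, map_add, map_sum, ← add_assoc, ← Finset.sum_add_distrib]
    simp only [G, Polynomial.map_add, Polynomial.map_sum, Polynomial.map_mul, Polynomial.map_C,
      Polynomial.map_pow, Polynomial.map_X, map_mul, map_pow,
      PowerSeries.constantCoeff_C, PowerSeries.constantCoeff_X, C_0]
    congr 1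
    refine Finset.sum_congr rfl fun n hn => ?_
    rw [Finset.sum_eq_sum_Ico_succ_bot (by have := hg3 n hn; omega), Nat.choose_one_right]
    simp only [Nat.sub_self, zero_mul, zero_add, pow_zero, mul_one]
    ring
  obtain ⟨y, hy, hy0⟩ := exists_powerSeries_root G (-(g.coeff (2 * κ + 2))⁻¹ * a) (by
    rw [hGm]
    simp [ha]) (by
    rw [hGm]
    simpa using ha)
  have hne : y ≠ 0 := by
    rintro rfl
    rw [map_zero] at hy0
    exact mul_ne_zero (neg_ne_zero.mpr (inv_ne_zero ha)) hA hy0.symm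
  refine exists_planarForm_eq_zero_of_powerSeries hcard hd hdq hg
    (mul_ne_zero (pow_ne_zero p PowerSeries.X_ne_zero) hne)
    (fun n => ∑ j ∈ Finset.Ico 1 n,
        PowerSeries.C (n.choose j : F) * PowerSeries.X ^ (j * p - (n - 2)) * y ^ j)
    (fun n hn => ?_) ?_
  · rw [pow_mul_sum_choose (by have := hg3 n hn; omega)]
    intro j hj h0
    have h1 := hle n hn j hj h0
    have h2 : j * p = (j - 1) * p + p := by
      rw [← Nat.succ_mul, Nat.succ_eq_add_one, Nat.sub_add_cancel hj]
    omega
  · have h1 : PowerSeries.X ^ (p + 1 - r) * y * G.eval y = 0 := by rw [hy, mul_zero]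
    rw [← h1]
    simp only [G, eval_add, eval_finsetSum, eval_mul, eval_C, eval_pow, eval_X, mul_add,
      Finset.mul_sum]
    congr 1
    · refine Finset.sum_congr rfl fun n hn => Finset.sum_congr rfl fun j hj => ?_
      obtain ⟨hj, -⟩ := Finset.mem_Ico.mp hj
      by_cases h0 : ((n.choose j : ℕ) : F) = 0
      · simp [h0]
      have h1 := hle n hn j hj h0
      have h2 : j * p = (j - 1) * p + p := by
        rw [← Nat.succ_mul, Nat.succ_eq_add_one, Nat.sub_add_cancel hj]
      have h4 := hg3 n hn
      have h3 : j * p - (n - 2) = (p + 1 - r) + ((j - 1) * p + r - (n - 1)) := by omega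
      have h5 : y ^ j = y * y ^ (j - 1) := by rw [← pow_succ', Nat.sub_add_cancel hj]
      rw [h3, h5, pow_add]
      ring
    · have h3 : p = (p + 1 - r) + (r - 1) := by omega
      conv_lhs => rw [h3, pow_add]
      ring

end

/-- The Lucas sequence with parameters `S` and `-Y`. -/
def lucasSeq {A : Type*} [CommRing A] (S Y : A) : ℕ → A
  | 0 => 0
  | 1 => 1
  | n + 2 => S * lucasSeq S Y (n + 1) + Y * lucasSeq S Y n

theorem map_lucasSeq {A B : Type*} [CommRing A] [CommRing B] (φ : A →+* B) (S Y : A) (n : ℕ) :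
    φ (lucasSeq S Y n) = lucasSeq (φ S) (φ Y) n := by
  induction n using Nat.twoStepInduction with
  | zero => exact map_zero φ
  | one => exact map_one φ
  | more n h1 h2 => rw [lucasSeq, lucasSeq, map_add, map_mul, map_mul, h1, h2]

theorem lucasSeq_zero_left {A : Type*} [CommRing A] (Y : A) (n : ℕ) :
    lucasSeq 0 Y (2 * n + 1) = Y ^ n := by
  induction n with
  | zero => simp [lucasSeq]
  | succ n ih => rw [mul_add, mul_one, add_right_comm, lucasSeq, ih, zero_mul, zero_add, pow_succ']

theorem pow_add_pow_eq_lucasSeq {A : Type*} [CommRing A] [CharP A 2] (x y : A) (n : ℕ) :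
    x ^ n + y ^ n = (x + y) * lucasSeq (x + y) (x * y) n := by
  have h2 : (2 : A) = 0 := CharTwo.two_eq_zero
  induction n using Nat.twoStepInduction with
  | zero =>
    simp only [lucasSeq]
    linear_combination h2
  | one => simp [lucasSeq]
  | more n h1 h2' =>
    rw [lucasSeq]
    linear_combination (x * y) * h1 + (x + y) * h2' - (x * y ^ (n + 1) + x ^ (n + 1) * y) * h2

theorem exists_pow_two_pow_eq {F : Type*} [Field F] [Finite F] [CharP F 2] (a : F) (v : ℕ) :
    ∃ c : F, c ^ 2 ^ v = a := by
  obtain ⟨c, hc⟩ := (iterateFrobeniusEquiv F 2 v).surjective a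
  exact ⟨c, by rw [← hc, iterateFrobeniusEquiv_def]⟩

section

variable {A : Type*} [CommRing A]

/-- The contribution of the exponent `n` in the ramified case. -/
def ramifiedTerm (c z : A) (κ w : ℕ) (Y : A) (n : ℕ) : A :=
  c ^ 2 ^ padicValNat 2 n * z ^ (κ * 2 ^ padicValNat 2 n - 2 ^ w * (n - 2)) *
    (lucasSeq (c * z ^ κ) Y (n / 2 ^ padicValNat 2 n) ^ 2 ^ padicValNat 2 n +
      (c * z ^ κ) ^ (n - 2 ^ padicValNat 2 n))

theorem map_ramifiedTerm {B : Type*} [CommRing B] (φ : A →+* B) (c z : A) (κ w : ℕ) (Y : A)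
    (n : ℕ) : φ (ramifiedTerm c z κ w Y n) = ramifiedTerm (φ c) (φ z) κ w (φ Y) n := by
  simp only [ramifiedTerm, map_mul, map_pow, map_add, map_lucasSeq]

theorem pow_mul_ramifiedTerm [CharP A 2] {c z x y : A} {κ w n : ℕ} (hn : n ≠ 0)
    (h : 2 ^ w * (n - 2) ≤ κ * 2 ^ padicValNat 2 n) (hS : x + y = c * z ^ κ) :
    z ^ (2 ^ w * (n - 2)) * ramifiedTerm c z κ w (x * y) n = x ^ n + y ^ n + (x + y) ^ n := by
  have h1 := (two_pow_mul_div hn).1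
  have h2 : z ^ (2 ^ w * (n - 2)) * z ^ (κ * 2 ^ padicValNat 2 n - 2 ^ w * (n - 2)) =
      (z ^ κ) ^ 2 ^ padicValNat 2 n := by
    rw [← pow_add, Nat.add_sub_cancel' h, pow_mul]
  have h3 : ∀ a : A, a ^ n = (a ^ (n / 2 ^ padicValNat 2 n)) ^ 2 ^ padicValNat 2 n := by
    intro a
    rw [← pow_mul, mul_comm, h1]
  have h4 : (x + y) ^ n = (x + y) ^ 2 ^ padicValNat 2 n * (x + y) ^ (n - 2 ^ padicValNat 2 n) := by
    rw [← pow_add, Nat.add_sub_cancel' (Nat.le_of_dvd (by omega) pow_padicValNat_dvd)]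
  rw [h4, h3 x, h3 y, ← add_pow_char_pow, pow_add_pow_eq_lucasSeq, mul_pow, ← mul_add, ramifiedTerm,
    ← hS, ← mul_assoc, ← mul_assoc, mul_right_comm _ (c ^ _), h2, hS,
    mul_pow c (z ^ κ) (2 ^ _), mul_comm (c ^ 2 ^ _) ((z ^ κ) ^ 2 ^ _)]

end

section

variable {F : Type*} [Field F] [CharP F 2]

theorem exists_ramified_root {g : F[X]} (hg : ∀ n ∈ g.support, n ≠ 0) {κ w l : ℕ} (hκ : 0 < κ)
    (hl : l ∈ g.support) (hw : padicValNat 2 l = w + 1) (hlκ : l = 2 * κ + 2)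
    (hl2 : ∀ r : ℕ, l ≠ 2 ^ r) {c : F} (hc : g.coeff l * c ^ 2 ^ (w + 1) = 1)
    (hmax : ∀ n ∈ g.support, n ≠ l → 2 ^ w * (n - 2) < κ * 2 ^ padicValNat 2 n) :
    ∃ Y : PowerSeries F, PowerSeries.constantCoeff Y = 1 ∧
      ∑ n ∈ g.support, PowerSeries.C (g.coeff n) *
        ramifiedTerm (PowerSeries.C c) PowerSeries.X κ w Y n + Y = 0 := by
  obtain ⟨h1, e, he⟩ := two_pow_mul_div (hg l hl)
  have hlt : 2 ^ padicValNat 2 l < l :=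
    lt_of_le_of_ne (Nat.le_of_dvd (Nat.pos_of_ne_zero (hg l hl)) pow_padicValNat_dvd)
      (fun h => hl2 _ h.symm)
  let G : (PowerSeries F)[X] := ∑ n ∈ g.support, C (PowerSeries.C (g.coeff n)) *
    ramifiedTerm (C (PowerSeries.C c)) (C PowerSeries.X) κ w X n + X
  have hGm : G.map PowerSeries.constantCoeff = X ^ (e * 2 ^ (w + 1)) + X := by
    simp only [G, Polynomial.map_add, Polynomial.map_sum, Polynomial.map_mul, Polynomial.map_C,
      Polynomial.map_X, ← coe_mapRingHom, map_ramifiedTerm]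
    simp only [coe_mapRingHom, Polynomial.map_C, Polynomial.map_X, PowerSeries.constantCoeff_C,
      PowerSeries.constantCoeff_X, C_0]
    congr 1
    rw [Finset.sum_eq_single_of_mem l hl]
    · rw [ramifiedTerm, he, zero_pow hκ.ne', mul_zero, lucasSeq_zero_left,
        zero_pow (show l - 2 ^ padicValNat 2 l ≠ 0 by omega), hw, show
          κ * 2 ^ (w + 1) - 2 ^ w * (l - 2) = 0 by
            rw [hlκ, Nat.add_sub_cancel, pow_succ]
            apply Nat.sub_eq_zero_of_le
            apply le_of_eq
            ring]
      rw [pow_zero, mul_one, add_zero, ← mul_assoc, ← C_pow, ← C_mul, hc, C_1, one_mul, pow_mul]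
    · intro n hn hnl
      rw [ramifiedTerm, zero_pow (by have := hmax n hn hnl; omega)]
      ring
  obtain ⟨Y, hY, hY0⟩ := exists_powerSeries_root G 1 (by
    rw [hGm]
    simp [CharTwo.add_self_eq_zero]) (by
    rw [hGm]
    simp [derivative_X_pow, pow_succ, CharTwo.two_eq_zero])
  refine ⟨Y, hY0, ?_⟩
  rw [← hY, ← coe_evalRingHom]
  simp only [G, map_add, map_sum, map_mul, map_ramifiedTerm]
  simp

theorem coeff_eq_zero_of_derivative {f : PowerSeries F} (hf : PowerSeries.derivative F f = 0)
    {j : ℕ} (hj : Odd j) : PowerSeries.coeff j f = 0 := by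
  obtain ⟨e, rfl⟩ := hj
  have h := congrArg (PowerSeries.coeff (2 * e)) hf
  simpa [PowerSeries.coeff_derivative, CharTwo.two_eq_zero] using h

theorem derivative_pow_even (f : PowerSeries F) {n : ℕ} (hn : Even n) :
    PowerSeries.derivative F (f ^ n) = 0 := by
  obtain ⟨e, rfl⟩ := hn
  rw [Derivation.leibniz_pow, ← two_mul, mul_smul, two_smul, CharTwo.add_self_eq_zero]

theorem derivative_ramifiedTerm (c : F) {κ w n : ℕ} (hw : 0 < w) (hn : n ≠ 0) (he : Even n)
    (Y : PowerSeries F) :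
    PowerSeries.derivative F (ramifiedTerm (PowerSeries.C c) PowerSeries.X κ w Y n) = 0 := by
  have h1 : Even (2 ^ padicValNat 2 n) := by
    have : padicValNat 2 n ≠ 0 := (dvd_iff_padicValNat_ne_zero hn).mp he.two_dvd
    exact (Nat.even_pow.mpr ⟨even_two, this⟩)
  have h2 : Even (2 ^ w) := Nat.even_pow.mpr ⟨even_two, hw.ne'⟩
  rw [ramifiedTerm, Derivation.leibniz, Derivation.leibniz, map_add, derivative_pow_even _ h1,
    derivative_pow_even _ h1, derivative_pow_even, derivative_pow_even]
  · simp
  · rcases le_total (2 ^ w * (n - 2)) (κ * 2 ^ padicValNat 2 n) with h | h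
    · exact (Nat.even_sub h).mpr (by simp [h1.mul_left κ, h2.mul_right (n - 2)])
    · rw [Nat.sub_eq_zero_of_le h]
      exact ⟨0, rfl⟩
  · exact (Nat.even_sub (Nat.le_of_dvd (by omega) pow_padicValNat_dvd)).mpr (by simp [h1, he])

/-- The quadratic equation attached to the ramified case has no root in power series. -/
theorem ramified_no_root {g : F[X]} (hg : ∀ n ∈ g.support, 3 ≤ n) {κ w : ℕ} (hw : 0 < w)
    (hκ : Odd κ) {c : F} (hc : c ≠ 0)
    (hmax : ∀ n ∈ g.support, Odd n → 2 ^ w * (n - 2) < κ)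
    {Y : PowerSeries F} (hY0 : PowerSeries.constantCoeff Y = 1)
    (hY : ∑ n ∈ g.support, PowerSeries.C (g.coeff n) *
      ramifiedTerm (PowerSeries.C c) PowerSeries.X κ w Y n + Y = 0)
    {k : Type*} [Field k] [CharP k 2] (φ : F →+* k) (e : PowerSeries k)
    (he : e ^ 2 + PowerSeries.C (φ c) * PowerSeries.X ^ κ * e + PowerSeries.map φ Y = 0) : False := by
  have hw2 : Even (2 ^ w) := Nat.even_pow.mpr ⟨even_two, hw.ne'⟩
  have hodd : ∀ j, Odd j → φ c * (if κ ≤ j then PowerSeries.coeff (j - κ) e else 0) +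
      φ (PowerSeries.coeff j Y) = 0 := by
    intro j hj
    have h := congrArg (PowerSeries.coeff j) he
    rw [map_add, map_add, coeff_eq_zero_of_derivative (derivative_pow_even e even_two) hj, mul_assoc,
      PowerSeries.coeff_C_mul, PowerSeries.coeff_X_pow_mul', PowerSeries.coeff_map, zero_add,
      map_zero] at h
    exact h
  have he0 : PowerSeries.constantCoeff e ≠ 0 := by
    intro h0
    have h := congrArg PowerSeries.constantCoeff he
    rw [map_add, map_add, map_mul, map_pow, h0, mul_zero, add_zero, zero_pow two_ne_zero, zero_add,
      ← PowerSeries.coeff_zero_eq_constantCoeff_apply, PowerSeries.coeff_map,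
      PowerSeries.coeff_zero_eq_constantCoeff_apply, hY0, map_one, map_zero] at h
    exact one_ne_zero h
  have hYκ : PowerSeries.coeff κ Y ≠ 0 := by
    intro h
    have h1 := hodd κ hκ
    rw [h, map_zero, add_zero, if_pos le_rfl, Nat.sub_self, PowerSeries.coeff_zero_eq_constantCoeff,
      mul_eq_zero, map_eq_zero] at h1
    exact h1.elim hc he0
  have hYj : ∀ j, Odd j → j < κ → PowerSeries.coeff j Y = 0 := by
    intro j hj hjκ
    have h1 := hodd j hj
    rwa [if_neg (by omega), mul_zero, zero_add, map_eq_zero] at h1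
  have hcoeff : ∀ j, Odd j → PowerSeries.coeff j Y = ∑ n ∈ g.support.filter Odd, g.coeff n *
      PowerSeries.coeff j (ramifiedTerm (PowerSeries.C c) PowerSeries.X κ w Y n) := by
    intro j hj
    have h := congrArg (PowerSeries.coeff j) hY
    rw [map_add, map_sum, map_zero, CharTwo.add_eq_zero] at h
    rw [← h, Finset.sum_filter]
    refine Finset.sum_congr rfl fun n hn => ?_
    rw [PowerSeries.coeff_C_mul]
    split_ifs with hno
    · rfl
    · rw [coeff_eq_zero_of_derivative (derivative_ramifiedTerm c hw (by have := hg n hn; omega)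
        (Nat.not_odd_iff_even.mp hno) Y) hj, mul_zero]
  rcases (g.support.filter Odd).eq_empty_or_nonempty with h0 | hne
  · exact hYκ (by rw [hcoeff κ hκ, h0, Finset.sum_empty])
  obtain ⟨l, hl, hlmax⟩ := (g.support.filter Odd).exists_max_image id hne
  obtain ⟨hls, hlo⟩ := Finset.mem_filter.mp hl
  have hterm : ∀ n, Odd n → ramifiedTerm (PowerSeries.C c) PowerSeries.X κ w Y n =
      PowerSeries.X ^ (κ - 2 ^ w * (n - 2)) * (PowerSeries.C c *
        (lucasSeq (PowerSeries.C c * PowerSeries.X ^ κ) Y n +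
          (PowerSeries.C c * PowerSeries.X ^ κ) ^ (n - 1))) := by
    intro n hno
    have hv : padicValNat 2 n = 0 := padicValNat.eq_zero_of_not_dvd (by
      rwa [← even_iff_two_dvd, Nat.not_even_iff_odd])
    rw [ramifiedTerm, hv]
    simp only [pow_zero, pow_one, mul_one, Nat.div_one]
    ring
  have hl1 := hmax l hls hlo
  have hl3 := hg l hls
  have hwl : 0 < 2 ^ w * (l - 2) := Nat.mul_pos (by positivity) (by omega)
  have hj : Odd (κ - 2 ^ w * (l - 2)) := Nat.Odd.sub_even hl1.le hκ (hw2.mul_right _)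
  have h1 := hYj _ hj (by omega)
  rw [hcoeff _ hj, Finset.sum_eq_single_of_mem l hl, hterm l hlo, PowerSeries.coeff_X_pow_mul',
    if_pos le_rfl, Nat.sub_self, PowerSeries.coeff_zero_eq_constantCoeff] at h1
  · obtain ⟨d, hd⟩ := hlo
    simp only [map_mul, map_add, map_pow, PowerSeries.constantCoeff_C, map_lucasSeq,
      PowerSeries.constantCoeff_X, hY0] at h1
    rw [zero_pow (by rintro rfl; simp at hκ), mul_zero, zero_pow (by omega), hd,
      lucasSeq_zero_left, one_pow, add_zero, mul_one, ← hd, mul_eq_zero] at h1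
    exact h1.elim (mem_support_iff.mp hls) hc
  · intro n hn hnl
    obtain ⟨hns, hno⟩ := Finset.mem_filter.mp hn
    have h3 : n ≤ l := hlmax n hn
    have h4 := hmax n hns hno
    have h5 : 2 ^ w * (n - 2) < 2 ^ w * (l - 2) :=
      Nat.mul_lt_mul_of_pos_left (by have := hg n hns; omega) (by positivity)
    rw [hterm n hno, PowerSeries.coeff_X_pow_mul', if_neg (by omega), mul_zero]

end

section Quadratic

variable {A : Type*} [CommRing A]

theorem monic_quadratic (S Y : A) : (X ^ 2 + (C S * X + C Y)).Monic :=
  monic_X_pow_add (lt_of_le_of_lt degree_linear_le (by norm_num))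

theorem irreducible_quadratic [IsDomain A] {S Y : A} (h : ∀ e, e ^ 2 + S * e + Y ≠ 0) :
    Irreducible (X ^ 2 + (C S * X + C Y)) := by
  have hnd : (X ^ 2 + (C S * X + C Y)).natDegree = 2 := by
    rw [natDegree_add_eq_left_of_natDegree_lt] <;> rw [natDegree_X_pow]
    exact lt_of_le_of_lt natDegree_linear_le (by norm_num)
  rw [(monic_quadratic S Y).irreducible_iff_roots_eq_zero_of_degree_le_three hnd.ge (by omega),
    Multiset.eq_zero_iff_forall_notMem]
  intro e he
  apply h e
  have := (mem_roots'.mp he).2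
  rw [IsRoot.def] at this
  rw [← this]
  simp
  ring

end Quadratic

theorem adjoinRoot_map_injective {A : Type*} [CommRing A] [IsDomain A] {p : A[X]} (hp : p.Monic)
    [IsDomain (AdjoinRoot p)] {s : A →+* A} (hs : Function.Injective s) (h : p ∣ p.map s)
    (hof : Function.Injective (AdjoinRoot.of p)) :
    Function.Injective (AdjoinRoot.map s p p h) := by
  have : Module.Finite A (AdjoinRoot p) := hp.finite_adjoinRoot
  rw [RingHom.injective_iff_ker_eq_bot]
  apply Ideal.eq_bot_of_comap_eq_bot (R := A)
  rw [eq_bot_iff]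
  intro a ha
  have h1 : AdjoinRoot.map s p p h (AdjoinRoot.of p a) = 0 := ha
  rw [AdjoinRoot.map_of] at h1
  rw [Ideal.mem_bot]
  apply hs
  apply hof
  rw [h1, map_zero, map_zero]

theorem exists_planarForm_eq_zero_of_four_dvd {F : Type*} [Field F] [CharP F 2] [Fintype F] {m : ℕ}
    (hcard : Fintype.card F = 2 ^ m) {g : F[X]}
    (hd : 3 ≤ g.natDegree) (hdq : g.natDegree ^ 4 ≤ Fintype.card F)
    (hg : ∀ n ∈ g.support, 2 ≤ n ∧ ∀ r : ℕ, n ≠ 2 ^ r) {l w : ℕ} (hl : l ∈ g.support)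
    (hmax : ∀ n ∈ g.support, n ≠ l →
      (n - 2) * 2 ^ padicValNat 2 l < (l - 2) * 2 ^ padicValNat 2 n)
    (hw0 : 0 < w) (hval : padicValNat 2 l = w + 1) :
    ∃ x₀ y₀ : F, x₀ ≠ 0 ∧ y₀ ≠ 0 ∧ planarForm (RingHom.id F) g x₀ y₀ = 0 := by
  have hg3 : ∀ n ∈ g.support, 3 ≤ n := by
    intro n hn
    have h1 := (hg n hn).1
    have h2 := (hg n hn).2 1
    omega
  obtain ⟨κ, hκ, rfl⟩ : ∃ κ, Odd κ ∧ l = 2 * κ + 2 := by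
    obtain ⟨o, ho⟩ := pow_padicValNat_dvd (p := 2) (n := l)
    obtain ⟨u, rfl⟩ := Nat.exists_eq_add_of_le' hw0
    have h3 := hg3 _ hl
    rw [hval, pow_succ, pow_succ] at ho
    have h4 : l = 4 * (2 ^ u * o) := by rw [ho]; ring
    exact ⟨2 * (2 ^ u * o) - 1, by rw [Nat.odd_iff]; omega, by omega⟩
  have hκ0 : 0 < κ := hκ.pos
  have hmax' : ∀ n ∈ g.support, n ≠ 2 * κ + 2 → 2 ^ w * (n - 2) < κ * 2 ^ padicValNat 2 n := by
    intro n hn hnl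
    have := hmax n hn hnl
    rw [hval, pow_succ, Nat.add_sub_cancel] at this
    nlinarith
  have hmax'' : ∀ n ∈ g.support, 2 ^ w * (n - 2) ≤ κ * 2 ^ padicValNat 2 n := by
    intro n hn
    by_cases hnl : n = 2 * κ + 2
    · rw [hnl, hval, Nat.add_sub_cancel, pow_succ]
      apply le_of_eq
      ring
    · exact (hmax' n hn hnl).le
  have ha : g.coeff (2 * κ + 2) ≠ 0 := mem_support_iff.mp hl
  obtain ⟨c, hc⟩ := exists_pow_two_pow_eq (g.coeff (2 * κ + 2))⁻¹ (w + 1)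
  have hc0 : c ≠ 0 := by
    rintro rfl
    rw [zero_pow (by positivity)] at hc
    exact inv_ne_zero ha hc.symm
  obtain ⟨Y, hY0, hY⟩ := exists_ramified_root (fun n hn => by have := hg3 n hn; omega) hκ0 hl hval rfl
    (hg _ hl).2 (by rw [hc, mul_inv_cancel₀ ha]) hmax'
  let k := AlgebraicClosure F
  let i := algebraMap F k
  have : CharP k 2 := charP_of_injective_algebraMap i.injective 2
  let s : k →+* k := FiniteField.frobeniusAlgHom F k
  have hs : ∀ a, PowerSeries.map s (PowerSeries.map i a) = PowerSeries.map i a := by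
    intro a
    ext n
    simp only [PowerSeries.coeff_map]
    exact AlgHom.commutes (FiniteField.frobeniusAlgHom F k) _
  have hsinj : Function.Injective (PowerSeries.map s) := by
    intro a b hab
    ext n
    apply s.injective
    simpa using congrArg (PowerSeries.coeff n) hab
  let S : PowerSeries k := PowerSeries.map i (PowerSeries.C c * PowerSeries.X ^ κ)
  let Z : PowerSeries k := PowerSeries.map i Y
  have hno : ∀ e : PowerSeries k, e ^ 2 + S * e + Z ≠ 0 := by
    intro e he
    refine ramified_no_root hg3 hw0 hκ hc0 (fun n hn hno => ?_) hY0 hY i e ?_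
    · have hv : padicValNat 2 n = 0 := padicValNat.eq_zero_of_not_dvd (by
        rwa [← even_iff_two_dvd, Nat.not_even_iff_odd])
      have h1 := hmax' n hn (by
        rintro rfl
        rw [hv] at hval
        omega)
      rwa [hv, pow_zero, mul_one] at h1
    · rw [← he]
      simp [S, Z]
  let p : (PowerSeries k)[X] := X ^ 2 + (C S * X + C Z)
  have hpm : p.Monic := monic_quadratic S Z
  have hpi : Irreducible p := irreducible_quadratic hno
  have hps : p.map (PowerSeries.map s) = p := by
    have hS : PowerSeries.map s S = S := hs _
    have hZ : PowerSeries.map s Z = Z := hs _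
    simp only [p, Polynomial.map_add, Polynomial.map_mul, Polynomial.map_pow, Polynomial.map_X,
      Polynomial.map_C, hS, hZ]
  have : IsDomain (AdjoinRoot p) := AdjoinRoot.isDomain_of_prime hpi.prime
  have hof : Function.Injective (AdjoinRoot.of p) :=
    AdjoinRoot.of.injective_of_degree_ne_zero (by
      intro h
      exact hpi.not_isUnit (hpm.isUnit_iff.mpr
        (hpm.natDegree_eq_zero.mp (natDegree_eq_zero_iff_degree_le_zero.mpr h.le))))
  have hroot : AdjoinRoot.root p ^ 2 + AdjoinRoot.of p S * AdjoinRoot.root p + AdjoinRoot.of p Z = 0 := by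
    have := AdjoinRoot.eval₂_root p
    simpa [p, add_assoc] using this
  have hnoroot : ∀ r, AdjoinRoot.root p ≠ AdjoinRoot.of p r := by
    intro r hr
    apply hno r
    apply hof
    rw [map_add, map_add, map_mul, map_pow, ← hr, hroot, map_zero]
  have : CharP (AdjoinRoot p) 2 := charP_of_injective_ringHom hof 2
  have h2 : (2 : AdjoinRoot p) = 0 := CharTwo.two_eq_zero
  have hxy : AdjoinRoot.root p * (AdjoinRoot.root p + AdjoinRoot.of p S) = AdjoinRoot.of p Z := by
    linear_combination hroot - AdjoinRoot.of p Z * h2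
  have hS : AdjoinRoot.root p + (AdjoinRoot.root p + AdjoinRoot.of p S) =
      AdjoinRoot.of p (PowerSeries.map i (PowerSeries.C c)) *
        AdjoinRoot.of p (PowerSeries.map i PowerSeries.X) ^ κ := by
    rw [← map_pow, ← map_mul, ← map_pow, ← map_mul]
    linear_combination AdjoinRoot.root p * h2
  have hT : ∀ n, AdjoinRoot.of p (PowerSeries.map i
      (ramifiedTerm (PowerSeries.C c) PowerSeries.X κ w Y n)) =
      ramifiedTerm (AdjoinRoot.of p (PowerSeries.map i (PowerSeries.C c)))
        (AdjoinRoot.of p (PowerSeries.map i PowerSeries.X)) κ w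
        (AdjoinRoot.root p * (AdjoinRoot.root p + AdjoinRoot.of p S)) n := by
    intro n
    rw [hxy, map_ramifiedTerm, map_ramifiedTerm]
  refine exists_planarForm_eq_zero_of_branch hcard hd hdq hg (D := AdjoinRoot p)
    (j := (AdjoinRoot.of p).comp PowerSeries.C)
    (σ := AdjoinRoot.map (PowerSeries.map s) p p (by rw [hps]))
    (adjoinRoot_map_injective hpm hsinj _ hof) (fun x => ?_)
    (x := AdjoinRoot.root p) (y := AdjoinRoot.root p + AdjoinRoot.of p S)
    (z := AdjoinRoot.of p (PowerSeries.map i PowerSeries.X)) ?_ ?_ ?_ ?_ ?_ ?_ (2 ^ w)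
    (fun n => AdjoinRoot.of p (PowerSeries.map i
      (ramifiedTerm (PowerSeries.C c) PowerSeries.X κ w Y n)))
    (fun n hn => ?_) ?_ ?_
  · rw [RingHom.comp_apply, AdjoinRoot.map_of, RingHom.comp_apply, PowerSeries.map_C]
    rfl
  · exact AdjoinRoot.map_root _ _ _ _
  · rw [map_add, AdjoinRoot.map_root, AdjoinRoot.map_of, hs]
  · rw [AdjoinRoot.map_of, hs]
  · intro h
    exact hnoroot 0 (by rw [h, map_zero])
  · intro h
    exact hnoroot (-S) (by rw [map_neg]; linear_combination h)
  · rw [PowerSeries.map_X, Ne, map_eq_zero_iff _ hof]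
    exact PowerSeries.X_ne_zero
  · rw [hT]
    exact pow_mul_ramifiedTerm (by have := hg3 n hn; omega) (hmax'' n hn) hS
  · rw [hxy]
    have h := congrArg (fun a => AdjoinRoot.of p (PowerSeries.map i a)) hY
    simp only [map_add, map_sum, map_mul, map_zero, PowerSeries.map_C] at h
    exact h
  · intro a _ h _
    refine hnoroot (PowerSeries.C a * PowerSeries.X ^ 2 ^ w) ?_
    rw [h, PowerSeries.map_X, map_mul, map_pow]
    rfl

theorem exists_planarForm_eq_zero_of_support {F : Type*} [Field F] [CharP F 2] [Fintype F] {m : ℕ}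
    (hcard : Fintype.card F = 2 ^ m) {g : F[X]} (hg0 : g ≠ 0)
    (hdq : g.natDegree ^ 4 ≤ Fintype.card F)
    (hg : ∀ n ∈ g.support, 2 ≤ n ∧ ∀ r : ℕ, n ≠ 2 ^ r) :
    ∃ x₀ y₀ : F, x₀ ≠ 0 ∧ y₀ ≠ 0 ∧ planarForm (RingHom.id F) g x₀ y₀ = 0 := by
  have hd : 3 ≤ g.natDegree := by
    have h1 := hg _ (natDegree_mem_support_of_nonzero hg0)
    have h2 := h1.2 1
    omega
  obtain ⟨l, hl, hmax⟩ := exists_dominant_exponent (support_nonempty.mpr hg0) fun n hn => (hg n hn).1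
  rcases h : padicValNat 2 l with _ | _ | w
  · exact exists_planarForm_eq_zero_of_odd hcard hd hdq hg hl hmax h
  · exact exists_planarForm_eq_zero_of_two_mul_odd hcard hd hdq hg hl hmax h
  · exact exists_planarForm_eq_zero_of_four_dvd hcard hd hdq hg hl hmax w.succ_pos h

/-- The part of a polynomial supported on the exponents satisfying `P`. -/
noncomputable def restrictSupport {F : Type*} [Semiring F] (P : ℕ → Prop) [DecidablePred P]
    (f : F[X]) : F[X] :=
  ∑ n ∈ f.support with P n, monomial n (f.coeff n)

section restrictSupport

variable {F : Type*} [Semiring F] (P : ℕ → Prop) [DecidablePred P] (f : F[X])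

theorem coeff_restrictSupport (n : ℕ) :
    (restrictSupport P f).coeff n = if P n then f.coeff n else 0 := by
  rw [restrictSupport, finsetSum_coeff]
  simp only [coeff_monomial, Finset.sum_ite_eq', Finset.mem_filter, mem_support_iff]
  by_cases h : f.coeff n = 0 <;> simp [h]

theorem restrictSupport_add_restrictSupport_not :
    restrictSupport P f + restrictSupport (fun n => ¬ P n) f = f := by
  ext n
  rw [coeff_add, coeff_restrictSupport, coeff_restrictSupport]
  by_cases h : P n <;> simp [h]

end restrictSupport

theorem eval_add_eval_add_eval_add {F : Type*} [CommRing F] [CharP F 2] {L : F[X]}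
    (hL : ∀ n ∈ L.support, n = 0 ∨ ∃ r : ℕ, n = 2 ^ r) (x y : F) :
    L.eval x + L.eval y + L.eval (x + y) = L.eval 0 := by
  simp only [eval_eq_sum, Polynomial.sum, ← Finset.sum_add_distrib]
  refine Finset.sum_congr rfl fun n hn => ?_
  have h2 : (2 : F) = 0 := CharTwo.two_eq_zero
  obtain rfl | ⟨r, rfl⟩ := hL n hn
  · linear_combination L.coeff 0 * h2
  · rw [add_pow_char_pow, zero_pow (by positivity)]
    linear_combination L.coeff (2 ^ r) * (x ^ 2 ^ r + y ^ 2 ^ r) * h2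

end PlanarTwo

theorem planar_low_degree_is_two_polynomial
    {K : Type*} [Field K] [Fintype K] (n : ℕ) (hn : 1 ≤ n)
    (hcard : Fintype.card K = 2 ^ n)
    (f : Polynomial K)
    (hdeg : f.natDegree ^ 4 ≤ Fintype.card K)
    (hplanar : ∀ ε : K, ε ≠ 0 →
      Function.Bijective fun x : K => f.eval (x + ε) + f.eval x + ε * x) :
    ∀ i : ℕ, 1 ≤ i → f.coeff i ≠ 0 → ∃ k : ℕ, i = 2 ^ k := by
  classical
  intro i hi hfi
  by_contra hpow
  have : CharP K 2 := PlanarTwo.charP_two_of_card hcard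
  let P : ℕ → Prop := fun n => n = 0 ∨ ∃ r : ℕ, n = 2 ^ r
  set L := PlanarTwo.restrictSupport P f with hL
  set g := PlanarTwo.restrictSupport (fun n => ¬ P n) f with hg
  have hf : L + g = f := PlanarTwo.restrictSupport_add_restrictSupport_not P f
  have hgc : ∀ n, g.coeff n = if ¬ P n then f.coeff n else 0 :=
    PlanarTwo.coeff_restrictSupport _ f
  have hgi : g.coeff i ≠ 0 := by
    rwa [hgc, if_pos (not_or.mpr ⟨by omega, hpow⟩)]
  have hgs : ∀ n ∈ g.support, 2 ≤ n ∧ ∀ r : ℕ, n ≠ 2 ^ r := by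
    intro n hn
    rw [Polynomial.mem_support_iff, hgc, ite_ne_right_iff, not_or, not_exists] at hn
    have := hn.1.2 0
    exact ⟨by have := hn.1.1; omega, hn.1.2⟩
  have hdg : g.natDegree ≤ f.natDegree := by
    rw [Polynomial.natDegree_le_iff_coeff_eq_zero]
    intro n hn
    rw [hgc, Polynomial.coeff_eq_zero_of_natDegree_lt hn, ite_self]
  have hLs : ∀ n ∈ L.support, P n := by
    intro n hn
    rw [Polynomial.mem_support_iff, PlanarTwo.coeff_restrictSupport, ite_ne_right_iff] at hn
    exact hn.1
  obtain ⟨x, y, hx, hy, hxy⟩ := PlanarTwo.exists_planarForm_eq_zero_of_support hcard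
    (fun h => hgi (by rw [h, Polynomial.coeff_zero]))
    ((Nat.pow_le_pow_left hdg 4).trans hdeg) hgs
  have hg0 : g.eval 0 = 0 := by
    rw [← Polynomial.coeff_zero_eq_eval_zero, hgc, if_neg (not_not.mpr (Or.inl rfl))]
  have hLxy := PlanarTwo.eval_add_eval_add_eval_add hLs x y
  have h2 : (2 : K) = 0 := CharTwo.two_eq_zero
  apply hy
  apply (hplanar x hx).injective
  rw [PlanarTwo.planarForm] at hxy
  simp only [← hf, Polynomial.eval_add, hg0, zero_add, add_comm y x]
  simp only [Polynomial.eval₂_id] at hxy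
  linear_combination hxy + hLxy - h2 * (L.eval x + g.eval x)
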